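/- arXiv:1207.6674 — 3 statements merged into one kernel-verified Lean document; each statement's English description precedes it below -/
import Mathlib

section
/- If log ρᵢ / log ρⱼ ∈ ℚ for all i,j ∈ {1,…,n}, then the dust-like attractor D and the touching attractor T (with the same contraction vector) are Lipschitz equivalent. -/
noncomputable section

open Set Metric MeasureTheory

/-- Distance between two sets. -/
def setDist {X : Type*} [MetricSpace X] (A B : Set X) : ℝ := sInf (Set.image2 dist A B)

/-- Lipschitz equivalence of two sets: a bi-Lipschitz bijection between them. -/
def LipEquivOn {X Y : Type*} [MetricSpace X] [MetricSpace Y] (E : Set X) (F : Set Y) : Prop :=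
  ∃ (f : X → Y) (c c' : ℝ), 0 < c ∧ c ≤ c' ∧ Set.BijOn f E F ∧
    ∀ x ∈ E, ∀ y ∈ E, c * dist x y ≤ dist (f x) (f y) ∧ dist (f x) (f y) ≤ c' * dist x y

/-- The affine contraction `x ↦ ρ i * x + t i`. -/
def affMap (r t : ℕ → ℝ) (i : ℕ) (x : ℝ) : ℝ := r i * x + t i

/-- Composition of the affine maps along a word (first letter outermost). -/
def affWord (r t : ℕ → ℝ) : List ℕ → ℝ → ℝ
  | [] => id
  | i :: w => affMap r t i ∘ affWord r t w

/-- Cylinder of a general IFS for a word over `Fin n`. -/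
def cylW {X : Type*} {n : ℕ} (Ψ : Fin n → X → X) (F : Set X) (w : List (Fin n)) : Set X :=
  (w.foldr (fun i g => Ψ i ∘ g) id) '' F

/-- A (separable) contraction vector `(ρ 0, …, ρ (n-1))` in `ℝ`. -/
structure ContractionVec (n : ℕ) (ρ : ℕ → ℝ) : Prop where
  three_le : 3 ≤ n
  pos : ∀ i, i < n → 0 < ρ i
  lt_one : ∀ i, i < n → ρ i < 1
  sum_lt : (∑ i ∈ Finset.range n, ρ i) < 1

/-- The touching IFS of the standing setup, together with its attractor `T`. -/
structure TouchingIFS (n : ℕ) (ρ : ℕ → ℝ) where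
  t : ℕ → ℝ
  T : Set ℝ
  order : ∀ i, i + 1 < n → affMap ρ t i 1 ≤ affMap ρ t (i + 1) 0
  left0 : affMap ρ t 0 0 = 0
  right1 : affMap ρ t (n - 1) 1 = 1
  touch_ex : ∃ i, i + 1 < n ∧ affMap ρ t i 1 = affMap ρ t (i + 1) 0
  compactT : IsCompact T
  nonemptyT : T.Nonempty
  invT : T = ⋃ i ∈ Finset.range n, affMap ρ t i '' T

/-- The dust-like, equally spaced IFS of the standing setup, with attractor `D`. -/
structure DustIFS (n : ℕ) (ρ : ℕ → ℝ) where
  d : ℕ → ℝ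
  D : Set ℝ
  left0 : affMap ρ d 0 0 = 0
  right1 : affMap ρ d (n - 1) 1 = 1
  equal_gap : ∀ i, i + 1 < n →
    affMap ρ d (i + 1) 0 - affMap ρ d i 1 = (1 - ∑ j ∈ Finset.range n, ρ j) / (n - 1)
  compactD : IsCompact D
  nonemptyD : D.Nonempty
  invD : D = ⋃ i ∈ Finset.range n, affMap ρ d i '' D

variable {n : ℕ} {ρ : ℕ → ℝ}

/-- Cylinder `T_w`. -/
def TouchingIFS.cyl (S : TouchingIFS n ρ) (w : List ℕ) : Set ℝ := affWord ρ S.t w '' S.T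

/-- `i` is a (left) touching letter. -/
def TouchingIFS.touch (S : TouchingIFS n ρ) (i : ℕ) : Prop :=
  i + 1 < n ∧ affMap ρ S.t i 1 = affMap ρ S.t (i + 1) 0

/-- Left touching patch `L_k(T_w)` (with `α` the initial touching run length). -/
def TouchingIFS.patchL (S : TouchingIFS n ρ) (α : ℕ) (w : List ℕ) (k : ℕ) : Set ℝ :=
  ⋃ j ∈ Finset.range α, S.cyl (w ++ List.replicate k 0 ++ [j])

/-- Right touching patch `R_k(T_w)` (with `β` the final touching run length). -/
def TouchingIFS.patchR (S : TouchingIFS n ρ) (β : ℕ) (w : List ℕ) (k : ℕ) : Set ℝ :=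
  ⋃ j ∈ Finset.Ico (n - β) n, S.cyl (w ++ List.replicate k (n - 1) ++ [j])

/-- `α` is the number of successive touching intervals at the beginning. -/
def TouchingIFS.alphaRun (S : TouchingIFS n ρ) (α : ℕ) : Prop :=
  1 ≤ α ∧ α < n ∧ (∀ i, i + 1 < α → S.touch i) ∧ ¬ S.touch (α - 1)

/-- `β` is the number of successive touching intervals at the end. -/
def TouchingIFS.betaRun (S : TouchingIFS n ρ) (β : ℕ) : Prop :=
  1 ≤ β ∧ β < n ∧ (∀ i, n - β ≤ i → i + 1 < n → S.touch i) ∧ ¬ S.touch (n - β - 1)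

/-- Cylinder `D_w`. -/
def DustIFS.cyl (Q : DustIFS n ρ) (w : List ℕ) : Set ℝ := affWord ρ Q.d w '' Q.D

/-- Left patch `L_k(D_w)`. -/
def DustIFS.patchL (Q : DustIFS n ρ) (α : ℕ) (w : List ℕ) (k : ℕ) : Set ℝ :=
  ⋃ j ∈ Finset.range α, Q.cyl (w ++ List.replicate k 0 ++ [j])

/-- Right patch `R_k(D_w)`. -/
def DustIFS.patchR (Q : DustIFS n ρ) (β : ℕ) (w : List ℕ) (k : ℕ) : Set ℝ :=
  ⋃ j ∈ Finset.Ico (n - β) n, Q.cyl (w ++ List.replicate k (n - 1) ++ [j])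

/-- `τ k` is the unique positive integer with `ρₙᵏ ρ₁ < ρ₁ ^ τ(k) ≤ ρₙᵏ`. -/
def tauSpec (ρ : ℕ → ℝ) (n : ℕ) (τ : ℕ → ℕ) : Prop :=
  ∀ k, 1 ≤ k → 1 ≤ τ k ∧ ρ (n - 1) ^ k * ρ 0 < ρ 0 ^ τ k ∧ ρ 0 ^ τ k ≤ ρ (n - 1) ^ k

/-- `Cᵏ = R_k(T_{i₀}) ∪ L_{τ(k)}(T_{i₀+1})`. -/
def Cset (S : TouchingIFS n ρ) (α β i₀ : ℕ) (τ : ℕ → ℕ) (k : ℕ) : Set ℝ :=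
  S.patchR β [i₀] k ∪ S.patchL α [i₀ + 1] (τ k)

/-- The touching letter `i` is left substitutable. -/
def TouchingIFS.LeftSub (S : TouchingIFS n ρ) (α : ℕ) (i : ℕ) : Prop :=
  ∃ (w : List ℕ) (a : ℕ) (k k' : ℕ), (∀ b ∈ w ++ [a], b < n) ∧
    Metric.diam (S.patchL α [i + 1] k) = Metric.diam (S.patchL α (i :: (w ++ [a])) k') ∧
    a ≠ 0 ∧ ∀ ℓ, S.touch ℓ → a ≠ ℓ + 1

/-- The touching letter `i` is right substitutable. -/
def TouchingIFS.RightSub (S : TouchingIFS n ρ) (β : ℕ) (i : ℕ) : Prop :=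
  ∃ (w : List ℕ) (a : ℕ) (k k' : ℕ), (∀ b ∈ w ++ [a], b < n) ∧
    Metric.diam (S.patchR β [i] k) = Metric.diam (S.patchR β ((i + 1) :: (w ++ [a])) k') ∧
    a ≠ n - 1 ∧ ¬ S.touch a

/-- Convex hull of a bounded set of reals: the minimal closed interval containing it. -/
def CH (B : Set ℝ) : Set ℝ := Set.Icc (sInf B) (sSup B)

/-- `[a,b]` is a maximal run of touching letters (a first-level connected component). -/
def TouchingIFS.run (S : TouchingIFS n ρ) (a b : ℕ) : Prop :=
  a ≤ b ∧ b < n ∧ (∀ i, a ≤ i → i < b → S.touch i) ∧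
  (a = 0 ∨ ¬ S.touch (a - 1)) ∧ (b = n - 1 ∨ ¬ S.touch b)

/-- Membership in the class `𝒯⁽¹⁾`: a `T`-separate copy `Ψ_w(T⁽¹⁾_j)`. -/
def TouchingIFS.T1mem (S : TouchingIFS n ρ) (X : Set ℝ) : Prop :=
  ∃ (w : List ℕ) (a b : ℕ), (∀ c ∈ w, c < n) ∧ S.run a b ∧
    X = affWord ρ S.t w '' (⋃ j ∈ Finset.Icc a b, S.cyl [j]) ∧
    0 < setDist X (S.T \ X)

/-- Membership in the class `𝒯⁽²⁾`: a copy `Ψ_w(T⁽²⁾_i) = Ψ_w(R₀(T_i) ∪ L₀(T_{i+1}))`. -/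
def TouchingIFS.T2mem (S : TouchingIFS n ρ) (α β : ℕ) (X : Set ℝ) : Prop :=
  ∃ (w : List ℕ) (i : ℕ), (∀ c ∈ w, c < n) ∧ S.touch i ∧
    X = affWord ρ S.t w '' (S.patchR β [i] 0 ∪ S.patchL α [i + 1] 0)

/-- An admissible family for the simple decomposition of `E` by the `A i`. -/
def GoodFam (E : Set ℝ) {k : ℕ} (A : Fin k → Set ℝ) (𝒮 : Finset (Set ℝ)) : Prop :=
  (∀ B ∈ 𝒮, IsCompact B ∧ B ⊆ E) ∧ (⋃ B ∈ 𝒮, B) = E ∧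
  (∀ B ∈ 𝒮, ∀ B' ∈ 𝒮, B ≠ B' → CH B ∩ CH B' = ∅) ∧ (∀ i, A i ∈ 𝒮)

/-! ## Combinatorics of words (written with the last letter first) -/

namespace LipT

structure Ctx where
  n : ℕ
  α : ℕ
  M : ℕ
  Q : ℕ
  q : ℕ → ℕ
  tch : ℕ → Prop
  hM : 1 ≤ M
  hQ : 1 ≤ Q
  hq : ∀ i, 1 ≤ q i
  hα0 : 1 ≤ α
  hαn : α < n
  htn : ∀ i, tch i → i + 1 < n
  htα : ∀ i, tch i → i + 1 ≠ α

namespace Ctx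
variable (c : Ctx)

def u (i : ℕ) : List ℕ :=
  List.replicate c.M c.α ++ (i + 1) :: (List.replicate (c.M - 1) i ++ List.replicate (2 * c.M) c.α)

def A (i j : ℕ) (z : List ℕ) : List ℕ := List.replicate (c.M * j) (c.n - 1) ++ i :: z

def X (i j : ℕ) (z : List ℕ) : List ℕ := List.replicate (c.q i + c.Q * j) 0 ++ (i + 1) :: z

def Y (i j : ℕ) (z : List ℕ) : List ℕ := c.u i ++ c.A i j z

def R (x y : List ℕ) : Prop := ∃ i j z, c.tch i ∧ x = c.X i j z ∧ y = c.Y i j z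

theorem rep_cons_inj {k : ℕ} : ∀ {r t a b : ℕ} {l l' : List ℕ}, a ≠ k → b ≠ k →
    List.replicate r k ++ a :: l = List.replicate t k ++ b :: l' → r = t ∧ a = b ∧ l = l' := by
  intro r
  induction r with
  | zero =>
    intro t a b l l' ha hb h
    cases t with
    | zero => simpa using h
    | succ t => simp [List.replicate_succ] at h; exact absurd h.1 ha
  | succ r ih =>
    intro t a b l l' ha hb h
    cases t with
    | zero => simp [List.replicate_succ] at h; exact absurd h.1.symm hb
    | succ t =>
      simp only [List.replicate_succ, List.cons_append, List.cons.injEq, true_and] at h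
      obtain ⟨h1, h2⟩ := ih ha hb h
      exact ⟨by omega, h2⟩

theorem X_inj {i j z i' j' z'} (h : c.X i j z = c.X i' j' z') : i = i' ∧ j = j' ∧ z = z' := by
  obtain ⟨h1, h2, h3⟩ := rep_cons_inj (by omega) (by omega) h
  have h2 : i = i' := by omega
  subst h2
  have : c.Q * j = c.Q * j' := by omega
  exact ⟨rfl, Nat.eq_of_mul_eq_mul_left c.hQ this, h3⟩

theorem Y_inj {i j z i' j' z'} (hi : c.tch i) (hi' : c.tch i') (h : c.Y i j z = c.Y i' j' z') :
    i = i' ∧ j = j' ∧ z = z' := by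
  have hl : (c.u i).length = (c.u i').length := by simp [u]
  obtain ⟨h1, h2⟩ := List.append_inj h hl
  have h3 := List.append_cancel_left h1
  simp only [List.cons.injEq] at h3
  have h4 : i = i' := by omega
  subst h4
  have := c.htn i hi
  obtain ⟨h5, _, h6⟩ := rep_cons_inj (by omega) (by omega) h2
  exact ⟨rfl, Nat.eq_of_mul_eq_mul_left c.hM h5, h6⟩

theorem X_head (i j z) : ∃ l, c.X i j z = 0 :: l := by
  have := c.hq i
  obtain ⟨k, hk⟩ : ∃ k, c.q i + c.Q * j = k + 1 := ⟨c.q i + c.Q * j - 1, by omega⟩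
  exact ⟨_, by rw [X, hk, List.replicate_succ, List.cons_append]⟩

theorem Y_head (i j z) : ∃ l, c.Y i j z = c.α :: l := by
  have := c.hM
  obtain ⟨k, hk⟩ : ∃ k, c.M = k + 1 := ⟨c.M - 1, by omega⟩
  refine ⟨List.replicate k c.α ++ (i + 1) :: (List.replicate (c.M - 1) i ++
    List.replicate (2 * c.M) c.α) ++ c.A i j z, ?_⟩
  rw [Y, u]
  nth_rewrite 1 [hk]
  rw [List.replicate_succ]; simp

theorem X_ne_Y (i j z i' j' z') : c.X i j z ≠ c.Y i' j' z' := by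
  obtain ⟨l, hl⟩ := c.X_head i j z
  obtain ⟨l', hl'⟩ := c.Y_head i' j' z'
  rw [hl, hl']
  have := c.hα0
  intro h
  simp only [List.cons.injEq] at h
  omega

open Classical in
def κ (x : List ℕ) : List ℕ :=
  if h : ∃ y, c.R x y ∨ c.R y x then h.choose else x

theorem κ_X {i j z} (hi : c.tch i) : c.κ (c.X i j z) = c.Y i j z := by
  have h : ∃ y, c.R (c.X i j z) y ∨ c.R y (c.X i j z) := ⟨_, Or.inl ⟨i, j, z, hi, rfl, rfl⟩⟩
  rw [κ, dif_pos h]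
  rcases h.choose_spec with ⟨i', j', z', hi', h1, h2⟩ | ⟨i', j', z', hi', h1, h2⟩
  · obtain ⟨rfl, rfl, rfl⟩ := c.X_inj h1
    exact h2
  · exact absurd h2 (c.X_ne_Y _ _ _ _ _ _)

theorem κ_Y {i j z} (hi : c.tch i) : c.κ (c.Y i j z) = c.X i j z := by
  have h : ∃ y, c.R (c.Y i j z) y ∨ c.R y (c.Y i j z) := ⟨_, Or.inr ⟨i, j, z, hi, rfl, rfl⟩⟩
  rw [κ, dif_pos h]
  rcases h.choose_spec with ⟨i', j', z', hi', h1, h2⟩ | ⟨i', j', z', hi', h1, h2⟩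
  · exact absurd h1.symm (c.X_ne_Y _ _ _ _ _ _)
  · obtain ⟨rfl, rfl, rfl⟩ := c.Y_inj hi hi' h2
    exact h1

theorem κ_of_ne {x} (h1 : ∀ i j z, c.tch i → x ≠ c.X i j z)
    (h2 : ∀ i j z, c.tch i → x ≠ c.Y i j z) : c.κ x = x := by
  rw [κ, dif_neg]
  rintro ⟨y, ⟨i, j, z, hi, h, -⟩ | ⟨i, j, z, hi, -, h⟩⟩
  · exact h1 i j z hi h
  · exact h2 i j z hi h

theorem κ_cases (x) : c.κ x = x ∨ ∃ i j z, c.tch i ∧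
    ((x = c.X i j z ∧ c.κ x = c.Y i j z) ∨ (x = c.Y i j z ∧ c.κ x = c.X i j z)) := by
  by_cases h1 : ∃ i j z, c.tch i ∧ x = c.X i j z
  · obtain ⟨i, j, z, hi, rfl⟩ := h1
    exact Or.inr ⟨i, j, z, hi, Or.inl ⟨rfl, c.κ_X hi⟩⟩
  by_cases h2 : ∃ i j z, c.tch i ∧ x = c.Y i j z
  · obtain ⟨i, j, z, hi, rfl⟩ := h2
    exact Or.inr ⟨i, j, z, hi, Or.inr ⟨rfl, c.κ_Y hi⟩⟩
  push Not at h1 h2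
  exact Or.inl (c.κ_of_ne h1 h2)

theorem κ_κ (x) : c.κ (c.κ x) = x := by
  rcases c.κ_cases x with h | ⟨i, j, z, hi, ⟨h, h'⟩ | ⟨h, h'⟩⟩
  · rw [h, h]
  · rw [h', c.κ_Y hi, h]
  · rw [h', c.κ_X hi, h]

/-- the swap applied before a letter `b` -/
def sw (b : ℕ) (x : List ℕ) : List ℕ := if b < c.α then c.κ x else x

theorem sw_sw (b x) : c.sw b (c.sw b x) = x := by
  unfold sw; split_ifs <;> simp [κ_κ]

def ψ : List ℕ → List ℕ
  | [] => []
  | b :: v => b :: c.sw b (ψ v)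

theorem ψ_inj : Function.Injective c.ψ := by
  intro v
  induction v with
  | nil => intro v' h; cases v' with
    | nil => rfl
    | cons b v' => simp [ψ] at h
  | cons b v ih => intro v' h; cases v' with
    | nil => simp [ψ] at h
    | cons b' v' =>
      simp only [ψ, List.cons.injEq] at h
      obtain ⟨rfl, h⟩ := h
      have := congrArg (c.sw b) h
      rw [sw_sw, sw_sw] at this
      rw [ih this]

def φ : List ℕ → List ℕ := Function.invFun c.ψ

theorem φ_ψ (v) : c.φ (c.ψ v) = v := Function.leftInverse_invFun c.ψ_inj v

def Val (w : List ℕ) : Prop := ∀ b ∈ w, b < c.n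

theorem val_cons {b w} : c.Val (b :: w) ↔ b < c.n ∧ c.Val w := by simp [Val]

theorem val_append {l w} : c.Val (l ++ w) ↔ c.Val l ∧ c.Val w := by
  simp only [Val, List.mem_append]
  constructor
  · intro h; exact ⟨fun b hb => h b (Or.inl hb), fun b hb => h b (Or.inr hb)⟩
  · rintro ⟨h1, h2⟩ b (hb | hb)
    exacts [h1 b hb, h2 b hb]

theorem val_rep {k b} (hb : b < c.n) : c.Val (List.replicate k b) := by
  intro x hx
  rw [List.eq_of_mem_replicate hx]; exact hb

theorem val_X {i j z} (hi : c.tch i) (hz : c.Val z) : c.Val (c.X i j z) := by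
  have h1 := c.htn i hi
  exact c.val_append.2 ⟨c.val_rep (by omega), c.val_cons.2 ⟨h1, hz⟩⟩

theorem val_of_X {i j z} (h : c.Val (c.X i j z)) : c.Val z :=
  (c.val_cons.1 (c.val_append.1 h).2).2

theorem val_of_A {i j z} (h : c.Val (c.A i j z)) : c.Val z :=
  (c.val_cons.1 (c.val_append.1 h).2).2

theorem val_of_Y {i j z} (h : c.Val (c.Y i j z)) : c.Val z :=
  c.val_of_A (c.val_append.1 h).2

theorem val_A {i j z} (hi : c.tch i) (hz : c.Val z) : c.Val (c.A i j z) := by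
  have h1 := c.htn i hi
  exact c.val_append.2 ⟨c.val_rep (by omega), c.val_cons.2 ⟨by omega, hz⟩⟩

theorem val_u {i} (hi : c.tch i) : c.Val (c.u i) := by
  have h1 := c.htn i hi
  exact c.val_append.2 ⟨c.val_rep c.hαn, c.val_cons.2 ⟨h1, c.val_append.2
    ⟨c.val_rep (by omega), c.val_rep c.hαn⟩⟩⟩

theorem val_Y {i j z} (hi : c.tch i) (hz : c.Val z) : c.Val (c.Y i j z) :=
  c.val_append.2 ⟨c.val_u hi, c.val_A hi hz⟩

theorem val_κ {x} (h : c.Val x) : c.Val (c.κ x) := by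
  rcases c.κ_cases x with h' | ⟨i, j, z, hi, ⟨h1, h'⟩ | ⟨h1, h'⟩⟩
  · rwa [h']
  · rw [h']; rw [h1] at h; exact c.val_Y hi (c.val_of_X h)
  · rw [h']; rw [h1] at h; exact c.val_X hi (c.val_of_Y h)

theorem val_sw {b x} (h : c.Val x) : c.Val (c.sw b x) := by
  unfold sw; split_ifs
  · exact c.val_κ h
  · exact h

theorem val_ψ {v} (h : c.Val v) : c.Val (c.ψ v) := by
  induction v with
  | nil => exact h
  | cons b v ih =>
    rw [val_cons] at h
    exact c.val_cons.2 ⟨h.1, c.val_sw (ih h.2)⟩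

/-! ### word ratios -/

def rr (ρ : ℕ → ℝ) : List ℕ → ℝ
  | [] => 1
  | b :: z => ρ b * rr ρ z

theorem rr_append (ρ : ℕ → ℝ) (l z) : rr ρ (l ++ z) = rr ρ l * rr ρ z := by
  induction l with
  | nil => simp [rr]
  | cons b l ih => simp [rr, ih, mul_assoc]

theorem rr_rep (ρ : ℕ → ℝ) (k b) : rr ρ (List.replicate k b) = ρ b ^ k := by
  induction k with
  | zero => simp [rr]
  | succ k ih => simp [List.replicate_succ, rr, ih, pow_succ, mul_comm]

/-- compatibility of the ratios -/
structure Rat (ρ : ℕ → ℝ) : Prop where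
  pos : ∀ b, b < c.n → 0 < ρ b
  lt1 : ∀ b, b < c.n → ρ b < 1
  eQ : ρ (c.n - 1) ^ c.M = ρ 0 ^ c.Q
  eq : ∀ i, c.tch i → ρ i ^ c.M * ρ c.α ^ (3 * c.M) = ρ 0 ^ c.q i

variable {c} {ρ : ℕ → ℝ}

theorem rr_pos (hR : c.Rat ρ) {w} (h : c.Val w) : 0 < rr ρ w := by
  induction w with
  | nil => simp [rr]
  | cons b w ih => rw [val_cons] at h; exact mul_pos (hR.pos b h.1) (ih h.2)

theorem rr_X (hR : c.Rat ρ) (i j z) : rr ρ (c.X i j z) = ρ 0 ^ c.q i * (ρ 0 ^ c.Q) ^ j * ρ (i + 1) * rr ρ z := by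
  rw [X, rr_append, rr_rep, rr, pow_add, pow_mul]; ring

theorem rr_A (hR : c.Rat ρ) (i j z) : rr ρ (c.A i j z) = (ρ 0 ^ c.Q) ^ j * ρ i * rr ρ z := by
  rw [A, rr_append, rr_rep, rr, pow_mul, hR.eQ]; ring

theorem rr_Y (hR : c.Rat ρ) {i} (hi : c.tch i) (j z) : rr ρ (c.Y i j z) = rr ρ (c.X i j z) := by
  rw [Y, rr_append, rr_A hR, rr_X hR, u, rr_append, rr, rr_append, rr_rep, rr_rep, rr_rep,
    ← hR.eq i hi]
  obtain ⟨k, hk⟩ : ∃ k, c.M = k + 1 := ⟨c.M - 1, by have := c.hM; omega⟩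
  rw [hk, Nat.add_sub_cancel]
  ring

theorem rr_κ (hR : c.Rat ρ) (x) : rr ρ (c.κ x) = rr ρ x := by
  rcases c.κ_cases x with h' | ⟨i, j, z, hi, ⟨h1, h'⟩ | ⟨h1, h'⟩⟩
  · rw [h']
  · rw [h', h1, rr_Y hR hi]
  · rw [h', h1, rr_Y hR hi]

theorem rr_sw (hR : c.Rat ρ) (b x) : rr ρ (c.sw b x) = rr ρ x := by
  unfold sw; split_ifs
  · exact rr_κ hR x
  · rfl

theorem rr_ψ (hR : c.Rat ρ) (v) : rr ρ (c.ψ v) = rr ρ v := by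
  induction v with
  | nil => rfl
  | cons b v ih => simp [ψ, rr, rr_sw hR, ih]

theorem exists_max (hR : c.Rat ρ) : ∃ m : ℝ, 0 < m ∧ m < 1 ∧ ∀ b, b < c.n → ρ b ≤ m := by
  have hn : (Finset.range c.n).Nonempty := ⟨c.α, Finset.mem_range.2 c.hαn⟩
  obtain ⟨b, hb, h⟩ := Finset.exists_max_image (Finset.range c.n) ρ hn
  rw [Finset.mem_range] at hb
  exact ⟨ρ b, hR.pos b hb, hR.lt1 b hb, fun b' hb' => h b' (Finset.mem_range.2 hb')⟩

theorem ψ_surj (hR : c.Rat ρ) {w} (hw : c.Val w) : ∃ v, c.Val v ∧ c.ψ v = w := by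
  obtain ⟨m, hm0, hm1, hm⟩ := exists_max hR
  have key : ∀ N : ℕ, ∀ w, c.Val w → m ^ N < rr ρ w → ∃ v, c.Val v ∧ c.ψ v = w := by
    intro N
    induction N with
    | zero =>
      intro w hw h
      exfalso
      have : rr ρ w ≤ 1 := by
        clear h
        induction w with
        | nil => simp [rr]
        | cons b w ih =>
          rw [val_cons] at hw
          exact mul_le_one₀ (hR.lt1 b hw.1).le (rr_pos hR hw.2).le (ih hw.2)
      simp at h; linarith
    | succ N ih =>
      intro w hw h
      cases w with
      | nil => exact ⟨[], hw, rfl⟩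
      | cons b w =>
        rw [val_cons] at hw
        have h2 : m ^ N < rr ρ (c.sw b w) := by
          rw [rr_sw hR]
          have h3 : rr ρ (b :: w) ≤ m * rr ρ w :=
            mul_le_mul_of_nonneg_right (hm b hw.1) (rr_pos hR hw.2).le
          rw [pow_succ] at h
          nlinarith
        obtain ⟨v, hv, e⟩ := ih _ (c.val_sw hw.2) h2
        exact ⟨b :: v, c.val_cons.2 ⟨hw.1, hv⟩, by rw [ψ, e, sw_sw]⟩
  obtain ⟨N, hN⟩ := exists_pow_lt_of_lt_one (rr_pos hR hw) hm1
  exact key N w hw hN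

theorem ψ_φ (hR : c.Rat ρ) {w} (hw : c.Val w) : c.ψ (c.φ w) = w := by
  obtain ⟨v, _, rfl⟩ := ψ_surj hR hw
  rw [φ_ψ]

theorem val_φ (hR : c.Rat ρ) {w} (hw : c.Val w) : c.Val (c.φ w) := by
  obtain ⟨v, hv, rfl⟩ := ψ_surj hR hw
  rwa [φ_ψ]

theorem rr_φ (hR : c.Rat ρ) {w} (hw : c.Val w) : rr ρ (c.φ w) = rr ρ w := by
  rw [← rr_ψ hR, ψ_φ hR hw]

theorem φ_cons (hR : c.Rat ρ) {b w} (hw : c.Val (b :: w)) : c.φ (b :: w) = b :: c.φ (c.sw b w) := by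
  rw [val_cons] at hw
  apply c.ψ_inj
  rw [ψ_φ hR (c.val_cons.2 hw), ψ, ψ_φ hR (c.val_sw hw.2), sw_sw]

theorem φ_hi (hR : c.Rat ρ) {b w} (hb : c.α ≤ b) (hw : c.Val (b :: w)) : c.φ (b :: w) = b :: c.φ w := by
  rw [φ_cons hR hw, sw, if_neg (by omega)]

theorem φ_fix (hR : c.Rat ρ) {b w} (hk : c.κ w = w) (hw : c.Val (b :: w)) : c.φ (b :: w) = b :: c.φ w := by
  rw [φ_cons hR hw, sw, hk, ite_self]

theorem φ_rep_hi (hR : c.Rat ρ) {b w} (k) (hb : c.α ≤ b) (hbn : b < c.n) (hw : c.Val w) :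
    c.φ (List.replicate k b ++ w) = List.replicate k b ++ c.φ w := by
  induction k with
  | zero => simp
  | succ k ih =>
    rw [List.replicate_succ, List.cons_append, φ_hi hR hb, ih, List.cons_append]
    exact c.val_append.2 ⟨c.val_rep (k := k + 1) hbn, hw⟩

theorem φ_A (hR : c.Rat ρ) {i j z} (hi : c.tch i) (hz : c.Val z) :
    c.φ (c.A i j z) = List.replicate (c.M * j) (c.n - 1) ++ c.φ (i :: z) := by
  have := c.hαn
  have := c.htn i hi
  exact φ_rep_hi hR _ (by omega) (by omega) (c.val_cons.2 ⟨by omega, hz⟩)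

theorem φ_u (hR : c.Rat ρ) {i w} (hi : c.tch i) (hw : c.Val w) : c.φ (c.u i ++ w) = c.u i ++ c.φ w := by
  have hin := c.htn i hi
  have hαn := c.hαn
  have hM := c.hM
  have hα0 := c.hα0
  have hiα := c.htα i hi
  -- the block of `i`
  have v1 : c.Val (List.replicate (2 * c.M) c.α ++ w) := c.val_append.2 ⟨c.val_rep hαn, hw⟩
  have e1 := φ_rep_hi hR (2 * c.M) le_rfl hαn hw
  have v2 : ∀ r, c.Val (List.replicate r i ++ (List.replicate (2 * c.M) c.α ++ w)) := fun r =>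
    c.val_append.2 ⟨c.val_rep (by omega), v1⟩
  have hα : ∃ l, List.replicate (2 * c.M) c.α ++ w = c.α :: l := by
    obtain ⟨k, hk⟩ : ∃ k, 2 * c.M = k + 1 := ⟨2 * c.M - 1, by omega⟩
    exact ⟨_, by rw [hk, List.replicate_succ, List.cons_append]⟩
  have fixlow : i < c.α → ∀ r, c.κ (List.replicate r i ++ (List.replicate (2 * c.M) c.α ++ w)) =
      List.replicate r i ++ (List.replicate (2 * c.M) c.α ++ w) := by
    intro hlow r
    apply κ_of_ne
    · intro i' j' z' hi' h
      obtain ⟨l, hl⟩ := hα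
      obtain ⟨l', hl'⟩ := c.X_head i' j' z'
      cases r with
      | zero =>
        simp only [List.replicate_zero, List.nil_append] at h
        rw [hl, hl'] at h
        simp only [List.cons.injEq] at h
        omega
      | succ r =>
        have h0 := h
        rw [hl', List.replicate_succ, List.cons_append] at h0
        simp only [List.cons.injEq] at h0
        obtain ⟨rfl, -⟩ := h0
        rw [hl, X] at h
        have := rep_cons_inj (by omega) (by omega) h
        exact c.htα i' hi' this.2.1.symm
    · intro i' j' z' hi' h
      cases r with
      | zero =>
        simp only [List.replicate_zero, List.nil_append] at h
        rw [Y, u, two_mul, List.replicate_add, List.append_assoc, List.append_assoc] at h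
        have h := List.append_cancel_left h
        obtain ⟨k, hk⟩ : ∃ k, c.M = k + 1 := ⟨c.M - 1, by omega⟩
        nth_rewrite 1 [hk] at h
        rw [List.replicate_succ] at h
        simp only [List.cons_append, List.cons.injEq] at h
        exact c.htα i' hi' h.1.symm
      | succ r =>
        obtain ⟨l', hl'⟩ := c.Y_head i' j' z'
        rw [hl', List.replicate_succ, List.cons_append] at h
        simp only [List.cons.injEq] at h
        omega
  have stp : ∀ r b, b = i ∨ b = i + 1 →
      c.φ (b :: (List.replicate r i ++ (List.replicate (2 * c.M) c.α ++ w))) =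
      b :: c.φ (List.replicate r i ++ (List.replicate (2 * c.M) c.α ++ w)) := by
    intro r b hb
    have hv : c.Val (b :: (List.replicate r i ++ (List.replicate (2 * c.M) c.α ++ w))) :=
      c.val_cons.2 ⟨by omega, v2 r⟩
    by_cases hlow : i < c.α
    · exact φ_fix hR (fixlow hlow r) hv
    · exact φ_hi hR (by omega) hv
  have e2 : ∀ r, c.φ (List.replicate r i ++ (List.replicate (2 * c.M) c.α ++ w)) =
      List.replicate r i ++ (List.replicate (2 * c.M) c.α ++ c.φ w) := by
    intro r
    induction r with
    | zero => simpa using e1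
    | succ r ih => rw [List.replicate_succ, List.cons_append, stp r i (Or.inl rfl), ih,
        List.cons_append]
  have e3 := stp (c.M - 1) (i + 1) (Or.inr rfl)
  rw [e2] at e3
  have e4 := φ_rep_hi hR c.M le_rfl hαn (c.val_cons.2 ⟨hin, v2 (c.M - 1)⟩)
  rw [e3] at e4
  simpa [u] using e4

theorem φ_Y (hR : c.Rat ρ) {i j z} (hi : c.tch i) (hz : c.Val z) :
    c.φ (c.Y i j z) = c.u i ++ c.φ (c.A i j z) := φ_u hR hi (c.val_A hi hz)

theorem κ_zeros (hR : c.Rat ρ) {i k z} (hi : c.tch i) (hk : ∀ j, k ≠ c.q i + c.Q * j) :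
    c.κ (List.replicate k 0 ++ (i + 1) :: z) = List.replicate k 0 ++ (i + 1) :: z := by
  apply κ_of_ne
  · intro i' j' z' _ h
    obtain ⟨h1, h2, h3⟩ := rep_cons_inj (by omega) (by omega) h
    have : i = i' := by omega
    subst this
    exact hk j' h1
  · intro i' j' z' _ h
    obtain ⟨l, hl⟩ := c.Y_head i' j' z'
    rw [hl] at h
    have := c.hα0
    cases k with
    | zero => simp at h; exact c.htα i hi h.1
    | succ k => simp [List.replicate_succ] at h; omega

theorem φ_zeros (hR : c.Rat ρ) {i z} (hi : c.tch i) (hz : c.Val z) (k0 s : ℕ)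
    (hk : ∀ s', s' < s → ∀ j, k0 + s' ≠ c.q i + c.Q * j) :
    c.φ (List.replicate (k0 + s) 0 ++ (i + 1) :: z) =
      List.replicate s 0 ++ c.φ (List.replicate k0 0 ++ (i + 1) :: z) := by
  have hin := c.htn i hi
  induction s with
  | zero => simp
  | succ s ih =>
    rw [← add_assoc, List.replicate_succ, List.cons_append, φ_fix hR, ih, List.replicate_succ,
      List.cons_append]
    · intro s' hs'; exact hk s' (by omega)
    · exact κ_zeros hR hi (hk s (by omega))
    · exact c.val_cons.2 ⟨by omega, c.val_append.2 ⟨c.val_rep (by omega), c.val_cons.2 ⟨hin, hz⟩⟩⟩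

theorem φ_X0 (hR : c.Rat ρ) {i z} (hi : c.tch i) (hz : c.Val z) :
    c.φ (c.X i 0 z) = List.replicate (c.q i) 0 ++ c.φ ((i + 1) :: z) := by
  have := φ_zeros hR hi hz 0 (c.q i) (fun s' h j => by omega)
  simpa [X] using this

theorem φ_Xs (hR : c.Rat ρ) {i j z} (hi : c.tch i) (hz : c.Val z) :
    c.φ (c.X i (j + 1) z) = List.replicate c.Q 0 ++ (c.u i ++ c.φ (c.A i j z)) := by
  have hin := c.htn i hi
  have hQ := c.hQ
  have h1 := φ_zeros hR hi hz (c.q i + c.Q * j + 1) (c.Q - 1) (fun s' h j' h' => by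
    have h2 : c.Q * j' = c.Q * j + (1 + s') := by omega
    have h3 : c.Q * j < c.Q * j' := by omega
    have h4 : j + 1 ≤ j' := Nat.lt_of_mul_lt_mul_left h3
    have h5 := Nat.mul_le_mul_left c.Q h4
    rw [mul_add] at h5
    omega)
  have e : c.q i + c.Q * j + 1 + (c.Q - 1) = c.q i + c.Q * (j + 1) := by
    rw [mul_add]; omega
  rw [e] at h1
  rw [X, h1, List.replicate_succ, List.cons_append, φ_cons hR, sw, if_pos (by have := c.hα0; omega)]
  · have : c.κ (List.replicate (c.q i + c.Q * j) 0 ++ (i + 1) :: z) = c.Y i j z := c.κ_X hi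
    rw [this, φ_Y hR hi hz]
    obtain ⟨k, hk⟩ : ∃ k, c.Q = k + 1 := ⟨c.Q - 1, by omega⟩
    rw [hk, Nat.add_sub_cancel, List.replicate_succ']
    simp
  · exact c.val_cons.2 ⟨by omega, c.val_X hi hz⟩

/-- the sibling property -/
theorem φ_sib (hR : c.Rat ρ) {i z} (hi : c.tch i) (hz : c.Val z) :
    c.φ (i :: z) = i :: c.φ (c.sw i z) ∧ c.φ ((i + 1) :: z) = (i + 1) :: c.φ (c.sw i z) := by
  have hin := c.htn i hi
  have := c.htα i hi
  refine ⟨φ_cons hR (c.val_cons.2 ⟨by omega, hz⟩), ?_⟩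
  rw [φ_cons hR (c.val_cons.2 ⟨by omega, hz⟩)]
  congr 2
  unfold sw
  by_cases h : i < c.α
  · rw [if_pos h, if_pos (by omega)]
  · rw [if_neg h, if_neg (by omega)]

end Ctx
end LipT

/-! ## From rough equivalence of indexed nets to Lipschitz equivalence -/

namespace LipT

def Rel {I : Type*} (d t s : I → ℝ) (x p : ℝ) : Prop :=
  ∀ ε > 0, ∃ v, s v < ε ∧ |x - d v| < ε ∧ |p - t v| < ε

theorem Rel.symm {I : Type*} {d t s : I → ℝ} {x p : ℝ} (h : Rel d t s x p) : Rel t d s p x := by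
  intro ε hε
  obtain ⟨v, h1, h2, h3⟩ := h ε hε
  exact ⟨v, h1, h3, h2⟩

theorem rel_exists {I : Type*} {D T : Set ℝ} (hT : IsClosed T) {d t s : I → ℝ} {C : ℝ}
    (hC : 1 ≤ C)
    (hDa : ∀ x ∈ D, ∀ ε > 0, ∃ v, |x - d v| < ε ∧ s v < ε)
    (hTc : ∀ v, ∃ x ∈ T, |x - t v| ≤ C * s v)
    (b1 : ∀ v v', |t v - t v'| ≤ C * (|d v - d v'| + s v + s v')) {x : ℝ} (hx : x ∈ D) :
    ∃ p ∈ T, Rel d t s x p := by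
  have hpos : ∀ k : ℕ, (0 : ℝ) < 1 / ((k : ℝ) + 1) := fun k => by positivity
  choose v hv1 hv2 using fun k : ℕ => hDa x hx _ (hpos k)
  have hlim := tendsto_one_div_add_atTop_nhds_zero_nat (𝕜 := ℝ)
  have hsmall : ∀ ε > 0, ∃ N : ℕ, ∀ k ≥ N, 1 / ((k : ℝ) + 1) < ε := by
    intro ε hε
    exact Filter.eventually_atTop.1 (hlim.eventually (gt_mem_nhds hε))
  have hc : CauchySeq (fun k => t (v k)) := by
    rw [Metric.cauchySeq_iff]
    intro ε hε
    obtain ⟨N, hN⟩ := hsmall (ε / (4 * C)) (by positivity)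
    refine ⟨N, fun k hk l hl => ?_⟩
    rw [Real.dist_eq]
    have h1 := hN k hk
    have h2 := hN l hl
    have h3 : |d (v k) - d (v l)| ≤ |x - d (v k)| + |x - d (v l)| := by
      have := abs_sub (x - d (v l)) (x - d (v k))
      rw [show x - d (v l) - (x - d (v k)) = d (v k) - d (v l) by ring] at this
      linarith
    have h4 : |d (v k) - d (v l)| + s (v k) + s (v l) < 4 * (ε / (4 * C)) := by
      linarith [hv1 k, hv1 l, hv2 k, hv2 l]
    calc _ ≤ _ := b1 (v k) (v l)
      _ < C * (4 * (ε / (4 * C))) := by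
        apply mul_lt_mul_of_pos_left h4; linarith
      _ = ε := by field_simp
  obtain ⟨p, hp⟩ := cauchySeq_tendsto_of_complete hc
  have hrel : Rel d t s x p := by
    intro ε hε
    obtain ⟨N, hN⟩ := hsmall ε hε
    obtain ⟨N', hN'⟩ := Metric.tendsto_atTop.1 hp ε hε
    refine ⟨v (max N N'), ?_, ?_, ?_⟩
    · exact (hv2 _).trans (hN _ (le_max_left _ _))
    · exact (hv1 _).trans (hN _ (le_max_left _ _))
    · have := hN' _ (le_max_right N N')
      rwa [dist_comm, Real.dist_eq] at this
  refine ⟨p, ?_, hrel⟩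
  rw [← hT.closure_eq, Metric.mem_closure_iff]
  intro ε hε
  obtain ⟨w, h1, h2, h3⟩ := hrel (ε / (2 * C)) (by positivity)
  obtain ⟨y, hy, hy'⟩ := hTc w
  refine ⟨y, hy, ?_⟩
  rw [Real.dist_eq]
  have h4 : |p - y| ≤ |p - t w| + |y - t w| := by
    have := abs_sub (p - t w) (y - t w)
    rwa [show p - t w - (y - t w) = p - y by ring] at this
  have h5 : ε / (2 * C) ≤ ε / 2 := by
    apply div_le_div_of_nonneg_left hε.le (by norm_num); linarith
  have h6 : C * s w < C * (ε / (2 * C)) := mul_lt_mul_of_pos_left h1 (by linarith)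
  have h7 : C * (ε / (2 * C)) = ε / 2 := by field_simp
  linarith

theorem rel_lip {I : Type*} {d t s : I → ℝ} {C : ℝ} (hC : 1 ≤ C)
    (b1 : ∀ v v', |t v - t v'| ≤ C * (|d v - d v'| + s v + s v')) {x y p q : ℝ}
    (h1 : Rel d t s x p) (h2 : Rel d t s y q) : |p - q| ≤ C * |x - y| := by
  apply le_of_forall_pos_le_add
  intro ε hε
  obtain ⟨v, v1, v2, v3⟩ := h1 (ε / (6 * C)) (by positivity)
  obtain ⟨w, w1, w2, w3⟩ := h2 (ε / (6 * C)) (by positivity)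
  have e1 : |p - q| ≤ |p - t v| + |t v - t w| + |q - t w| := by
    have := abs_sub (p - t v + (t v - t w)) (q - t w)
    have := abs_add_le (p - t v) (t v - t w)
    rw [show p - q = p - t v + (t v - t w) - (q - t w) by ring]
    linarith
  have e2 : |d v - d w| ≤ |x - y| + |x - d v| + |y - d w| := by
    have := abs_sub (x - y + (y - d w)) (x - d v)
    have := abs_add_le (x - y) (y - d w)
    rw [show d v - d w = x - y + (y - d w) - (x - d v) by ring]
    linarith
  have e3 := b1 v w
  have e4 : |d v - d w| + s v + s w ≤ |x - y| + 4 * (ε / (6 * C)) := by linarith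
  have e5 : C * (|d v - d w| + s v + s w) ≤ C * (|x - y| + 4 * (ε / (6 * C))) :=
    mul_le_mul_of_nonneg_left e4 (by linarith)
  have e6 : C * (|x - y| + 4 * (ε / (6 * C))) = C * |x - y| + 4 * ε / 6 := by field_simp
  have e7 : ε / (6 * C) ≤ ε / 6 := by
    apply div_le_div_of_nonneg_left hε.le (by norm_num); linarith
  linarith

theorem rough {I : Type*} {D T : Set ℝ} (hD : IsClosed D) (hT : IsClosed T) {d t s : I → ℝ}
    {C : ℝ} (hC : 1 ≤ C)
    (hDa : ∀ x ∈ D, ∀ ε > 0, ∃ v, |x - d v| < ε ∧ s v < ε)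
    (hTa : ∀ x ∈ T, ∀ ε > 0, ∃ v, |x - t v| < ε ∧ s v < ε)
    (hDc : ∀ v, ∃ x ∈ D, |x - d v| ≤ C * s v)
    (hTc : ∀ v, ∃ x ∈ T, |x - t v| ≤ C * s v)
    (b1 : ∀ v v', |t v - t v'| ≤ C * (|d v - d v'| + s v + s v'))
    (b2 : ∀ v v', |d v - d v'| ≤ C * (|t v - t v'| + s v + s v')) :
    LipEquivOn D T := by
  have h1 : ∀ x, ∃ p, x ∈ D → p ∈ T ∧ Rel d t s x p := by
    intro x
    by_cases hx : x ∈ D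
    · obtain ⟨p, hp, h⟩ := rel_exists hT hC hDa hTc b1 hx
      exact ⟨p, fun _ => ⟨hp, h⟩⟩
    · exact ⟨0, fun h => absurd h hx⟩
  choose f hf using h1
  have hCpos : 0 < C := by linarith
  have low : ∀ x ∈ D, ∀ y ∈ D, |x - y| ≤ C * |f x - f y| := fun x hx y hy =>
    rel_lip hC b2 (hf x hx).2.symm (hf y hy).2.symm
  refine ⟨f, 1 / C, C, by positivity, ?_, ⟨?_, ?_, ?_⟩, ?_⟩
  · rw [div_le_iff₀ hCpos]; nlinarith
  · intro x hx; exact (hf x hx).1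
  · intro x hx y hy h
    have := low x hx y hy
    rw [h, sub_self, abs_zero, mul_zero] at this
    exact sub_eq_zero.1 (abs_eq_zero.1 (le_antisymm this (abs_nonneg _)))
  · intro p hp
    obtain ⟨x, hx, h⟩ := rel_exists hD hC hTa hDc b2 hp
    refine ⟨x, hx, ?_⟩
    have := rel_lip hC b1 (hf x hx).2 h.symm
    rw [sub_self, abs_zero, mul_zero] at this
    exact sub_eq_zero.1 (abs_eq_zero.1 (le_antisymm this (abs_nonneg _)))
  · intro x hx y hy
    rw [Real.dist_eq, Real.dist_eq]
    refine ⟨?_, rel_lip hC b1 (hf x hx).2 (hf y hy).2⟩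
    rw [one_div, inv_mul_le_iff₀ hCpos]
    exact low x hx y hy

/-! ## Geometry of the cylinders -/

namespace Ctx

/-- left end point of the cylinder of a (reversed) word -/
def Lp (ρ t : ℕ → ℝ) : List ℕ → ℝ
  | [] => 0
  | b :: z => Lp ρ t z + rr ρ z * t b

structure Geo (c : Ctx) (ρ t : ℕ → ℝ) : Prop where
  t0 : ∀ b, b < c.n → 0 ≤ t b
  t1 : ∀ b, b < c.n → t b + ρ b ≤ 1

variable {c : Ctx} {ρ t : ℕ → ℝ}

theorem Lp_ext (hR : c.Rat ρ) (hG : c.Geo ρ t) {l z} (hl : c.Val l) (hz : c.Val z) :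
    Lp ρ t z ≤ Lp ρ t (l ++ z) ∧ Lp ρ t (l ++ z) + rr ρ (l ++ z) ≤ Lp ρ t z + rr ρ z := by
  induction l with
  | nil => simp
  | cons b l ih =>
    rw [val_cons] at hl
    obtain ⟨h1, h2⟩ := ih hl.2
    have hp := rr_pos hR (c.val_append.2 ⟨hl.2, hz⟩)
    have a := hG.t0 b hl.1
    have b' := hG.t1 b hl.1
    simp only [List.cons_append, Lp, rr]
    constructor
    · have := mul_nonneg hp.le a; linarith
    · nlinarith

theorem Lp_near (hR : c.Rat ρ) (hG : c.Geo ρ t) {l z} (hl : c.Val l) (hz : c.Val z) :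
    |Lp ρ t (l ++ z) - Lp ρ t z| ≤ rr ρ z := by
  obtain ⟨h1, h2⟩ := Lp_ext hR hG hl hz
  have := rr_pos hR (c.val_append.2 ⟨hl, hz⟩)
  rw [abs_le]; constructor <;> linarith [rr_pos hR hz]

theorem Lp_sep (hR : c.Rat ρ) (hG : c.Geo ρ t) {l l' z b b' g} (hv : c.Val (l ++ b :: z))
    (hv' : c.Val (l' ++ b' :: z)) (hg : g ≤ t b' - t b - ρ b) :
    g * rr ρ z ≤ Lp ρ t (l' ++ b' :: z) - (Lp ρ t (l ++ b :: z) + rr ρ (l ++ b :: z)) := by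
  rw [val_append] at hv hv'
  obtain ⟨h1, h2⟩ := Lp_ext hR hG hv.1 hv.2
  obtain ⟨h3, h4⟩ := Lp_ext hR hG hv'.1 hv'.2
  have hp := rr_pos hR (c.val_cons.1 hv.2).2
  simp only [Lp, rr] at *
  nlinarith

theorem split (v : List ℕ) : ∀ v', (∃ l, v = l ++ v') ∨ (∃ l, v' = l ++ v) ∨
    ∃ l l' b b' z, b ≠ b' ∧ v = l ++ b :: z ∧ v' = l' ++ b' :: z := by
  induction v using List.reverseRecOn with
  | nil => intro v'; exact Or.inr (Or.inl ⟨v', by simp⟩)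
  | append_singleton v b ih =>
    intro v'
    induction v' using List.reverseRecOn with
    | nil => exact Or.inl ⟨v ++ [b], by simp⟩
    | append_singleton v' b' _ =>
      by_cases h : b = b'
      · subst h
        rcases ih v' with ⟨l, h⟩ | ⟨l, h⟩ | ⟨l, l', a, a', z, ha, h1, h2⟩
        · exact Or.inl ⟨l, by rw [h, List.append_assoc]⟩
        · exact Or.inr (Or.inl ⟨l, by rw [h, List.append_assoc]⟩)
        · exact Or.inr (Or.inr ⟨l, l', a, a', z ++ [b], ha, by simp [h1], by simp [h2]⟩)
      · exact Or.inr (Or.inr ⟨v, v', b, b', [], h, rfl, rfl⟩)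

theorem telescope (hR : c.Rat ρ) {m : ℝ} (hm1 : m < 1) (hm : ∀ b, b < c.n → ρ b ≤ m)
    {h : List ℕ → ℝ} {K : ℝ} (hK : 0 ≤ K)
    (H : ∀ b w, c.Val (b :: w) → |h (b :: w) - h w| ≤ K * rr ρ w) {l z}
    (hv : c.Val (l ++ z)) : |h (l ++ z) - h z| ≤ K / (1 - m) * rr ρ z := by
  have h1m : 0 < 1 - m := by linarith
  have key : |h (l ++ z) - h z| ≤ K / (1 - m) * (rr ρ z - rr ρ (l ++ z)) := by
    induction l with
    | nil => simp
    | cons b l ih =>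
      have hv' := (c.val_cons.1 hv)
      have i1 := ih hv'.2
      have i2 := H b (l ++ z) hv
      have hp : 0 < rr ρ (l ++ z) := rr_pos hR hv'.2
      have hb := hm b hv'.1
      have i3 : K * rr ρ (l ++ z) ≤ K / (1 - m) * (rr ρ (l ++ z) - ρ b * rr ρ (l ++ z)) := by
        rw [div_mul_eq_mul_div, le_div_iff₀ h1m, mul_assoc]
        apply mul_le_mul_of_nonneg_left _ hK
        nlinarith
      have i4 := abs_add_le (h (b :: (l ++ z)) - h (l ++ z)) (h (l ++ z) - h z)
      rw [sub_add_sub_cancel] at i4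
      simp only [List.cons_append, rr]
      have i5 : K / (1 - m) * (rr ρ z - ρ b * rr ρ (l ++ z)) =
        K / (1 - m) * (rr ρ z - rr ρ (l ++ z)) +
          K / (1 - m) * (rr ρ (l ++ z) - ρ b * rr ρ (l ++ z)) := by ring
      linarith
  refine key.trans (mul_le_mul_of_nonneg_left ?_ (by positivity))
  have := rr_pos hR hv
  linarith

/-- lower bounds for the finitely many constants -/
structure Low (c : Ctx) (ρ : ℕ → ℝ) (e : ℝ) : Prop where
  pos : 0 < e
  le1 : e ≤ 1
  lr : ∀ b, b < c.n → e ≤ ρ b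
  lQ : e ≤ ρ 0 ^ c.Q
  lq : ∀ i, i < c.n → e ≤ ρ 0 ^ c.q i

theorem exists_lower (k : ℕ) (f : ℕ → ℝ) (hf : ∀ i, i < k → 0 < f i) :
    ∃ e : ℝ, 0 < e ∧ ∀ i, i < k → e ≤ f i := by
  induction k with
  | zero => exact ⟨1, one_pos, fun i h => by omega⟩
  | succ k ih =>
    obtain ⟨e, he, h⟩ := ih (fun i hi => hf i (by omega))
    refine ⟨min e (f k), lt_min he (hf k (by omega)), fun i hi => ?_⟩
    by_cases hik : i = k
    · subst hik; exact min_le_right _ _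
    · exact (min_le_left _ _).trans (h i (by omega))

theorem exists_low (hR : c.Rat ρ) : ∃ e, Low c ρ e := by
  have h0 : 0 < ρ 0 := hR.pos 0 (by have := c.hαn; omega)
  obtain ⟨e1, h1, h1'⟩ := exists_lower c.n ρ hR.pos
  obtain ⟨e2, h2, h2'⟩ := exists_lower c.n (fun i => ρ 0 ^ c.q i) (fun i _ => pow_pos h0 _)
  refine ⟨min (min e1 e2) (min 1 (ρ 0 ^ c.Q)), ?_, ?_, ?_, ?_, ?_⟩
  · exact lt_min (lt_min h1 h2) (lt_min one_pos (pow_pos h0 _))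
  · exact (min_le_right _ _).trans (min_le_left _ _)
  · exact fun b hb => (min_le_left _ _).trans ((min_le_left _ _).trans (h1' b hb))
  · exact (min_le_right _ _).trans (min_le_right _ _)
  · exact fun b hb => (min_le_left _ _).trans ((min_le_right _ _).trans (h2' b hb))

theorem A_le_X (hR : c.Rat ρ) {e} (he : Low c ρ e) {i j z} (hi : c.tch i) (hz : c.Val z) :
    e ^ 2 * rr ρ (c.A i j z) ≤ rr ρ (c.X i j z) := by
  have hin := c.htn i hi
  have hp := rr_pos hR hz
  have h0 : 0 < ρ 0 := hR.pos 0 (by omega)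
  have hs : 0 < (ρ 0 ^ c.Q) ^ j := by positivity
  rw [rr_A hR, rr_X hR]
  have h1 : e * e ≤ ρ 0 ^ c.q i * ρ (i + 1) :=
    mul_le_mul (he.lq i (by omega)) (he.lr _ hin) he.pos.le (by positivity)
  have h2 : ρ i ≤ 1 := (hR.lt1 i (by omega)).le
  have h3 : e * e * ρ i ≤ ρ 0 ^ c.q i * ρ (i + 1) :=
    (mul_le_of_le_one_right (mul_nonneg he.pos.le he.pos.le) h2).trans h1
  calc _ = (e * e * ρ i) * ((ρ 0 ^ c.Q) ^ j * rr ρ z) := by ring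
    _ ≤ (ρ 0 ^ c.q i * ρ (i + 1)) * ((ρ 0 ^ c.Q) ^ j * rr ρ z) :=
      mul_le_mul_of_nonneg_right h3 (by positivity)
    _ = _ := by ring

theorem X_le_A (hR : c.Rat ρ) {e} (he : Low c ρ e) {i j z} (hi : c.tch i) (hz : c.Val z) :
    e * rr ρ (c.X i j z) ≤ rr ρ (c.A i j z) := by
  have hin := c.htn i hi
  have hp := rr_pos hR hz
  have h0 : 0 < ρ 0 := hR.pos 0 (by omega)
  have h01 : ρ 0 ≤ 1 := (hR.lt1 0 (by omega)).le
  have hs : 0 < (ρ 0 ^ c.Q) ^ j := by positivity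
  rw [rr_A hR, rr_X hR]
  have h1 : ρ 0 ^ c.q i * ρ (i + 1) ≤ 1 :=
    mul_le_one₀ (pow_le_one₀ h0.le h01) (hR.pos _ hin).le (hR.lt1 _ hin).le
  have h3 : e * (ρ 0 ^ c.q i * ρ (i + 1)) ≤ ρ i :=
    (mul_le_of_le_one_right he.pos.le h1).trans (he.lr i (by omega))
  calc _ = e * (ρ 0 ^ c.q i * ρ (i + 1)) * ((ρ 0 ^ c.Q) ^ j * rr ρ z) := by ring
    _ ≤ ρ i * ((ρ 0 ^ c.Q) ^ j * rr ρ z) :=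
      mul_le_mul_of_nonneg_right h3 (by positivity)
    _ = _ := by ring

theorem A_succ (hR : c.Rat ρ) {e} (he : Low c ρ e) {i j z} (hi : c.tch i) (hz : c.Val z) :
    e * rr ρ (c.A i j z) ≤ rr ρ (c.A i (j + 1) z) := by
  have h : rr ρ (c.A i (j + 1) z) = ρ 0 ^ c.Q * rr ρ (c.A i j z) := by
    rw [rr_A hR, rr_A hR, pow_succ]; ring
  rw [h]
  exact mul_le_mul_of_nonneg_right he.lQ (rr_pos hR (c.val_A hi hz)).le

theorem A_zero (hR : c.Rat ρ) {e} (he : Low c ρ e) {i z} (hi : c.tch i) (hz : c.Val z) :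
    e * rr ρ z ≤ rr ρ (c.A i 0 z) := by
  have hin := c.htn i hi
  rw [rr_A hR]
  simpa using mul_le_mul_of_nonneg_right (he.lr i (by omega)) (rr_pos hR hz).le

/-! ### the dust side -/

theorem dust_XA (hR : c.Rat ρ) {d : ℕ → ℝ} (hG : c.Geo ρ d) {e} (he : Low c ρ e) {i j z}
    (hi : c.tch i) (hz : c.Val z) :
    |Lp ρ d (c.φ (c.X i j z)) - Lp ρ d (c.φ (c.A i j z))| ≤ 2 / e * rr ρ (c.A i j z) := by
  have hin := c.htn i hi
  have hαn := c.hαn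
  rw [div_mul_eq_mul_div, le_div_iff₀ he.pos]
  have tri : ∀ x y w r : ℝ, |x - w| ≤ r → |y - w| ≤ r → |x - y| ≤ 2 * r := by
    intro x y w r h1 h2
    rw [abs_le] at *
    constructor <;> linarith
  cases j with
  | zero =>
    have hsib := φ_sib hR hi hz
    have hA : c.A i 0 z = i :: z := by simp [A]
    have hvs := val_φ hR (c.val_sw (b := i) hz)
    have e1 : Lp ρ d (c.φ (c.X i 0 z)) =
        Lp ρ d ((List.replicate (c.q i) 0 ++ [i + 1]) ++ c.φ (c.sw i z)) := by
      rw [φ_X0 hR hi hz, hsib.2]; simp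
    have e2 : Lp ρ d (c.φ (c.A i 0 z)) = Lp ρ d ([i] ++ c.φ (c.sw i z)) := by
      rw [hA, hsib.1]; simp
    have h1 := Lp_near hR hG (l := List.replicate (c.q i) 0 ++ [i + 1])
      (c.val_append.2 ⟨c.val_rep (by omega), fun b hb => by simp at hb; omega⟩) hvs
    have h2 := Lp_near hR hG (l := [i]) (fun b hb => by simp at hb; omega) hvs
    rw [rr_φ hR (c.val_sw hz), rr_sw hR] at h1 h2
    have h3 := tri _ _ _ _ h1 h2
    have h4 := A_zero hR he hi hz
    rw [e1, e2]
    have := he.pos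
    nlinarith
  | succ j =>
    have hvA := val_φ hR (c.val_A (j := j) hi hz)
    have e1 : Lp ρ d (c.φ (c.X i (j + 1) z)) =
        Lp ρ d ((List.replicate c.Q 0 ++ c.u i) ++ c.φ (c.A i j z)) := by
      rw [φ_Xs hR hi hz]; simp
    have e2 : Lp ρ d (c.φ (c.A i (j + 1) z)) =
        Lp ρ d (List.replicate c.M (c.n - 1) ++ c.φ (c.A i j z)) := by
      rw [φ_A hR hi hz, φ_A hR hi hz, ← List.append_assoc, ← List.replicate_add]
      congr 3; ring
    have h1 := Lp_near hR hG (l := List.replicate c.Q 0 ++ c.u i)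
      (c.val_append.2 ⟨c.val_rep (by omega), c.val_u hi⟩) hvA
    have h2 := Lp_near hR hG (l := List.replicate c.M (c.n - 1)) (c.val_rep (by omega)) hvA
    rw [rr_φ hR (c.val_A hi hz)] at h1 h2
    have h3 := tri _ _ _ _ h1 h2
    have h4 := A_succ hR he (j := j) hi hz
    rw [e1, e2]
    have := he.pos
    nlinarith

theorem dust_step (hR : c.Rat ρ) {d : ℕ → ℝ} (hG : c.Geo ρ d) {e} (he : Low c ρ e) {b w}
    (hw : c.Val (b :: w)) :
    |Lp ρ d (c.φ (b :: w)) - Lp ρ d (c.φ w)| ≤ (1 + (2 / e + 1) / e ^ 2) * rr ρ w := by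
  have hw' := c.val_cons.1 hw
  have hp := rr_pos hR hw'.2
  have he0 := he.pos
  have XY : ∀ i j z, c.tch i → c.Val z →
      |Lp ρ d (c.φ (c.X i j z)) - Lp ρ d (c.φ (c.Y i j z))| ≤
        (2 / e + 1) / e ^ 2 * rr ρ (c.X i j z) := by
    intro i j z hi hz
    have h1 := dust_XA hR hG he (j := j) hi hz
    have h2 := Lp_near hR hG (c.val_u hi) (val_φ hR (c.val_A (j := j) hi hz))
    rw [← φ_Y hR hi hz, rr_φ hR (c.val_A hi hz)] at h2
    have h3 := A_le_X hR he (j := j) hi hz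
    have h4 : |Lp ρ d (c.φ (c.X i j z)) - Lp ρ d (c.φ (c.Y i j z))| ≤
        (2 / e + 1) * rr ρ (c.A i j z) := by
      rw [abs_le] at *
      constructor <;> linarith
    refine h4.trans ?_
    rw [div_mul_eq_mul_div, le_div_iff₀ (by positivity), mul_assoc]
    apply mul_le_mul_of_nonneg_left _ (by positivity)
    linarith
  have key : |Lp ρ d (c.φ (c.sw b w)) - Lp ρ d (c.φ w)| ≤ (2 / e + 1) / e ^ 2 * rr ρ w := by
    unfold sw
    split_ifs
    · rcases c.κ_cases w with h' | ⟨i, j, z, hi, ⟨h1, h'⟩ | ⟨h1, h'⟩⟩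
      · rw [h', sub_self, abs_zero]; positivity
      · rw [h']; subst h1
        rw [abs_sub_comm]; exact XY i j z hi (c.val_of_X hw'.2)
      · rw [h']; subst h1
        rw [rr_Y hR hi]; exact XY i j z hi (c.val_of_Y hw'.2)
    · rw [sub_self, abs_zero]; positivity
  have h5 := Lp_near hR hG (l := [b]) (z := c.φ (c.sw b w)) (fun x hx => by simp at hx; omega)
    (val_φ hR (c.val_sw hw'.2))
  rw [rr_φ hR (c.val_sw hw'.2), rr_sw hR] at h5
  rw [φ_cons hR hw]
  simp only [List.cons_append, List.nil_append] at h5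
  rw [abs_le] at *
  constructor <;> linarith

/-! ### the touching side -/

structure TGeo (c : Ctx) (ρ t : ℕ → ℝ) : Prop extends Geo c ρ t where
  z0 : t 0 = 0
  z1 : t (c.n - 1) + ρ (c.n - 1) = 1
  ord : ∀ b b', b < b' → b' < c.n → t b + ρ b ≤ t b'
  tt : ∀ i, c.tch i → t (i + 1) = t i + ρ i

theorem Lp_zeros (hG : c.TGeo ρ t) (k y) : Lp ρ t (List.replicate k 0 ++ y) = Lp ρ t y := by
  induction k with
  | zero => simp
  | succ k ih => simp [List.replicate_succ, Lp, ih, hG.z0]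

theorem Lp_lasts (hG : c.TGeo ρ t) (k y) :
    Lp ρ t (List.replicate k (c.n - 1) ++ y) + rr ρ (List.replicate k (c.n - 1) ++ y) =
      Lp ρ t y + rr ρ y := by
  induction k with
  | zero => simp
  | succ k ih =>
    simp only [List.replicate_succ, Lp, rr, List.cons_append]
    have := hG.z1
    linear_combination ih + rr ρ (List.replicate k (c.n - 1) ++ y) * this

theorem touch_XA (hG : c.TGeo ρ t) {i j z} (hi : c.tch i) :
    Lp ρ t (c.X i j z) = Lp ρ t (c.A i j z) + rr ρ (c.A i j z) := by
  rw [X, A, Lp_zeros hG, Lp_lasts hG]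
  simp only [Lp, rr, hG.tt i hi]; ring

theorem touch_step (hR : c.Rat ρ) (hG : c.TGeo ρ t) {e} (he : Low c ρ e) {b v}
    (hv : c.Val (b :: v)) :
    |Lp ρ t (c.ψ (b :: v)) - Lp ρ t (c.ψ v)| ≤ (1 + 1 / e ^ 2) * rr ρ v := by
  have hv' := c.val_cons.1 hv
  have he0 := he.pos
  have XY : ∀ i j z, c.tch i → c.Val z →
      |Lp ρ t (c.X i j z) - Lp ρ t (c.Y i j z)| ≤ 1 / e ^ 2 * rr ρ (c.X i j z) := by
    intro i j z hi hz
    have h1 := touch_XA hG (j := j) (z := z) hi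
    obtain ⟨h2, h3⟩ := Lp_ext hR hG.toGeo (c.val_u hi) (c.val_A (j := j) hi hz)
    have h4 := A_le_X hR he (j := j) hi hz
    have h5 := rr_pos hR (c.val_Y (j := j) hi hz)
    rw [← Y] at h2 h3
    rw [div_mul_eq_mul_div, le_div_iff₀ (by positivity), one_mul]
    have h6 : |Lp ρ t (c.X i j z) - Lp ρ t (c.Y i j z)| ≤ rr ρ (c.A i j z) := by
      rw [abs_le]; constructor <;> linarith [rr_pos hR (c.val_A (j := j) hi hz)]
    have := mul_le_mul_of_nonneg_right h6 (sq_nonneg e)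
    linarith
  have hw := c.val_ψ hv'.2
  have key : |Lp ρ t (c.sw b (c.ψ v)) - Lp ρ t (c.ψ v)| ≤ 1 / e ^ 2 * rr ρ (c.ψ v) := by
    have hp := rr_pos hR hw
    generalize c.ψ v = w at hw hp
    unfold sw
    split_ifs
    · rcases c.κ_cases w with h' | ⟨i, j, z, hi, ⟨h1, h'⟩ | ⟨h1, h'⟩⟩
      · rw [h', sub_self, abs_zero]; positivity
      · rw [h']; subst h1
        rw [abs_sub_comm]; exact XY i j z hi (c.val_of_X hw)
      · rw [h']; subst h1
        rw [rr_Y hR hi]; exact XY i j z hi (c.val_of_Y hw)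
    · rw [sub_self, abs_zero]; positivity
  have h5 := Lp_near hR hG.toGeo (l := [b]) (z := c.sw b (c.ψ v))
    (fun x hx => by simp at hx; omega) (c.val_sw hw)
  rw [rr_sw hR, rr_ψ hR] at h5
  rw [rr_ψ hR] at key
  simp only [List.cons_append, List.nil_append] at h5
  rw [ψ]
  rw [abs_le] at *
  constructor <;> linarith

theorem left_end (hR : c.Rat ρ) (hG : c.TGeo ρ t) {l y} (hw : c.Val (l ++ y)) (k : ℕ) :
    (∃ l', l ++ y = l' ++ (List.replicate k 0 ++ y)) ∨
      rr ρ (List.replicate k 0 ++ y) ≤ Lp ρ t (l ++ y) - Lp ρ t y + rr ρ (l ++ y) := by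
  have h0n : 0 < c.n := by have := c.hαn; omega
  have hvy := (c.val_append.1 hw).2
  induction k with
  | zero => exact Or.inl ⟨l, by simp⟩
  | succ k ih =>
    have hz : c.Val (List.replicate k 0 ++ y) := c.val_append.2 ⟨c.val_rep h0n, hvy⟩
    have hp := rr_pos hR hz
    have e1 : rr ρ (List.replicate (k + 1) 0 ++ y) = ρ 0 * rr ρ (List.replicate k 0 ++ y) := by
      simp [List.replicate_succ, rr]
    have e2 : ρ 0 * rr ρ (List.replicate k 0 ++ y) ≤ rr ρ (List.replicate k 0 ++ y) :=
      mul_le_of_le_one_left hp.le (hR.lt1 0 h0n).le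
    rw [e1]
    rcases ih with ⟨l', h⟩ | h
    · rcases List.eq_nil_or_concat l' with rfl | ⟨l'', b, rfl⟩
      · right
        rw [h, List.nil_append, Lp_zeros hG]
        linarith
      · rw [List.concat_eq_append, List.append_assoc, List.singleton_append] at h
        by_cases hb : b = 0
        · left
          exact ⟨l'', by rw [h, hb, List.replicate_succ, List.cons_append]⟩
        · right
          rw [h] at hw ⊢
          have hw2 := c.val_append.1 hw
          have hbn := (c.val_cons.1 hw2.2).1
          obtain ⟨h1, _⟩ := Lp_ext hR hG.toGeo hw2.1 hw2.2
          have h2 := hG.ord 0 b (by omega) hbn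
          have h3 := rr_pos hR hw
          rw [hG.z0] at h2
          simp only [Lp, Lp_zeros hG] at h1
          nlinarith
    · right; linarith

theorem right_end (hR : c.Rat ρ) (hG : c.TGeo ρ t) {l y} (hw : c.Val (l ++ y)) (k : ℕ) :
    (∃ l', l ++ y = l' ++ (List.replicate k (c.n - 1) ++ y)) ∨
      rr ρ (List.replicate k (c.n - 1) ++ y) ≤ Lp ρ t y + rr ρ y - Lp ρ t (l ++ y) := by
  have h0n : c.n - 1 < c.n := by have := c.hαn; omega
  have hvy := (c.val_append.1 hw).2
  induction k with
  | zero => exact Or.inl ⟨l, by simp⟩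
  | succ k ih =>
    have hz : c.Val (List.replicate k (c.n - 1) ++ y) := c.val_append.2 ⟨c.val_rep h0n, hvy⟩
    have hp := rr_pos hR hz
    have e1 : rr ρ (List.replicate (k + 1) (c.n - 1) ++ y) =
        ρ (c.n - 1) * rr ρ (List.replicate k (c.n - 1) ++ y) := by
      simp [List.replicate_succ, rr]
    have e2 : ρ (c.n - 1) * rr ρ (List.replicate k (c.n - 1) ++ y) ≤
        rr ρ (List.replicate k (c.n - 1) ++ y) :=
      mul_le_of_le_one_left hp.le (hR.lt1 _ h0n).le
    have e3 := Lp_lasts hG k y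
    rw [e1]
    rcases ih with ⟨l', h⟩ | h
    · rcases List.eq_nil_or_concat l' with rfl | ⟨l'', b, rfl⟩
      · right
        rw [h, List.nil_append]
        linarith
      · rw [List.concat_eq_append, List.append_assoc, List.singleton_append] at h
        by_cases hb : b = c.n - 1
        · left
          exact ⟨l'', by rw [h, hb, List.replicate_succ, List.cons_append]⟩
        · right
          rw [h] at hw ⊢
          have hw2 := c.val_append.1 hw
          have hbn := (c.val_cons.1 hw2.2).1
          obtain ⟨_, h1⟩ := Lp_ext hR hG.toGeo hw2.1 hw2.2
          have h2 := hG.ord b (c.n - 1) (by omega) h0n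
          have h3 := rr_pos hR hw
          have h4 := hG.z1
          simp only [Lp, rr] at h1
          nlinarith
    · right; linarith

end Ctx
end LipT

namespace LipT
namespace Ctx
variable {c : Ctx} {ρ t : ℕ → ℝ}

theorem combine (hR : c.Rat ρ) {h f : List ℕ → ℝ} {K C : ℝ} (hK : 0 ≤ K) (hC : 0 ≤ C)
    (tel : ∀ l z, c.Val (l ++ z) → |h (l ++ z) - h z| ≤ K * rr ρ z)
    (H : ∀ l l' b b' z, b < b' → c.Val (l ++ b :: z) → c.Val (l' ++ b' :: z) →
      |h (l ++ b :: z) - h (l' ++ b' :: z)| ≤ C * (|f (l ++ b :: z) - f (l' ++ b' :: z)| +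
        rr ρ (l ++ b :: z) + rr ρ (l' ++ b' :: z)))
    {v v'} (hv : c.Val v) (hv' : c.Val v') :
    |h v - h v'| ≤ (K + C) * (|f v - f v'| + rr ρ v + rr ρ v') := by
  have p1 := rr_pos hR hv
  have p2 := rr_pos hR hv'
  have p3 := abs_nonneg (f v - f v')
  have aux : ∀ a b : ℝ, 0 ≤ a → 0 ≤ b → K * b ≤ (K + C) * (a + b) := by
    intro a b ha hb
    have := mul_nonneg hK ha
    have := mul_nonneg hC (add_nonneg ha hb)
    nlinarith
  rcases split v v' with ⟨l, rfl⟩ | ⟨l, rfl⟩ | ⟨l, l', b, b', z, hb, rfl, rfl⟩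
  · exact (tel _ _ hv).trans (aux _ _ (by positivity) p2.le)
  · rw [abs_sub_comm]
    refine (tel _ _ hv').trans ((aux (|f v - f (l ++ v)| + rr ρ (l ++ v)) _ (by positivity)
      p1.le).trans (le_of_eq (by ring)))
  · have hh : |h (l ++ b :: z) - h (l' ++ b' :: z)| ≤ C * (|f (l ++ b :: z) - f (l' ++ b' :: z)| +
        rr ρ (l ++ b :: z) + rr ρ (l' ++ b' :: z)) := by
      rcases lt_or_gt_of_ne hb with hb | hb
      · exact H _ _ _ _ _ hb hv hv'
      · have := H _ _ _ _ _ hb hv' hv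
        rw [abs_sub_comm (h _), abs_sub_comm (f _)] at this
        linarith
    refine hh.trans (mul_le_mul_of_nonneg_right (by linarith) (by positivity))

theorem sep_case (hR : c.Rat ρ) (hG : c.Geo ρ t) {h : List ℕ → ℝ} {K g : ℝ} (hK : 0 ≤ K)
    (tel : ∀ l z, c.Val (l ++ z) → |h (l ++ z) - h z| ≤ K * rr ρ z) (hg0 : 0 < g)
    {l l' b b' z} (hv : c.Val (l ++ b :: z))
    (hv' : c.Val (l' ++ b' :: z)) (hg : g ≤ t b' - t b - ρ b) :
    |h (l ++ b :: z) - h (l' ++ b' :: z)| ≤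
      2 * K / g * (|Lp ρ t (l ++ b :: z) - Lp ρ t (l' ++ b' :: z)| +
        rr ρ (l ++ b :: z) + rr ρ (l' ++ b' :: z)) := by
  have p1 := rr_pos hR hv
  have p2 := rr_pos hR hv'
  have s := Lp_sep hR hG hv hv' hg
  have s' := neg_abs_le (Lp ρ t (l ++ b :: z) - Lp ρ t (l' ++ b' :: z))
  have t1 := tel (l ++ [b]) z (by simpa using hv)
  have t2 := tel (l' ++ [b']) z (by simpa using hv')
  rw [List.append_assoc, List.singleton_append] at t1 t2
  have t3 : |h (l ++ b :: z) - h (l' ++ b' :: z)| ≤ 2 * K * rr ρ z := by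
    rw [abs_le] at *
    constructor <;> linarith
  refine t3.trans ?_
  rw [div_mul_eq_mul_div, le_div_iff₀ hg0, mul_assoc]
  apply mul_le_mul_of_nonneg_left _ (by positivity)
  linarith

theorem bound1 (hR : c.Rat ρ) {d : ℕ → ℝ} (hD : c.Geo ρ d) (hG : c.TGeo ρ t) {g : ℝ} (hg0 : 0 < g)
    (hg : ∀ b b', b < b' → b' < c.n → g ≤ d b' - d b - ρ b) :
    ∃ C : ℝ, 0 ≤ C ∧ ∀ v v', c.Val v → c.Val v' →
      |Lp ρ t (c.ψ v) - Lp ρ t (c.ψ v')| ≤ C * (|Lp ρ d v - Lp ρ d v'| + rr ρ v + rr ρ v') := by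
  obtain ⟨e, he⟩ := exists_low hR
  obtain ⟨m, _, hm1, hm⟩ := exists_max hR
  have he0 := he.pos
  have h1m : 0 < 1 - m := by linarith
  have hK : 0 ≤ (1 + 1 / e ^ 2) / (1 - m) := by positivity
  have tel := fun l z hv => telescope hR hm1 hm (h := fun v => Lp ρ t (c.ψ v))
    (K := 1 + 1 / e ^ 2) (by positivity) (fun b w hw => touch_step hR hG he hw) (l := l) (z := z) hv
  refine ⟨(1 + 1 / e ^ 2) / (1 - m) + 2 * ((1 + 1 / e ^ 2) / (1 - m)) / g, by positivity,
    fun v v' hv hv' => ?_⟩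
  exact combine hR (h := fun v => Lp ρ t (c.ψ v)) (f := Lp ρ d) hK (by positivity) tel
    (fun l l' b b' z hb h1 h2 => sep_case (h := fun v => Lp ρ t (c.ψ v)) hR hD hK tel hg0 h1 h2
      (hg b b' hb (c.val_cons.1 (c.val_append.1 h2).2).1)) hv hv'

theorem touch_case (hR : c.Rat ρ) {d : ℕ → ℝ} (hD : c.Geo ρ d) (hG : c.TGeo ρ t) {e}
    (he : Low c ρ e) {K : ℝ} (hK : 0 ≤ K)
    (tel : ∀ l z, c.Val (l ++ z) →
      |Lp ρ d (c.φ (l ++ z)) - Lp ρ d (c.φ z)| ≤ K * rr ρ z)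
    {l l' i z} (hi : c.tch i) (hv : c.Val (l ++ i :: z)) (hv' : c.Val (l' ++ (i + 1) :: z)) :
    |Lp ρ d (c.φ (l ++ i :: z)) - Lp ρ d (c.φ (l' ++ (i + 1) :: z))| ≤
      (2 * K + 2 / e + K / e) / e ^ 3 *
        (|Lp ρ t (l ++ i :: z) - Lp ρ t (l' ++ (i + 1) :: z)| +
        rr ρ (l ++ i :: z) + rr ρ (l' ++ (i + 1) :: z)) := by
  have hz : c.Val z := (c.val_cons.1 (c.val_append.1 hv).2).2
  have he0 := he.pos
  have he1 := he.le1
  have p1 := rr_pos hR hv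
  have p2 := rr_pos hR hv'
  obtain ⟨x1, x2⟩ := Lp_ext hR hG.toGeo (c.val_append.1 hv).1 (c.val_append.1 hv).2
  obtain ⟨y1, y2⟩ := Lp_ext hR hG.toGeo (c.val_append.1 hv').1 (c.val_append.1 hv').2
  have hxy : Lp ρ t ((i + 1) :: z) = Lp ρ t (i :: z) + rr ρ (i :: z) := by
    simp only [Lp, rr, hG.tt i hi]; ring
  have s' := neg_abs_le (Lp ρ t (l ++ i :: z) - Lp ρ t (l' ++ (i + 1) :: z))
  set w := l ++ i :: z with hw
  set w' := l' ++ (i + 1) :: z with hw'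
  have red : ∀ B : ℝ, e ^ 3 * B ≤ |Lp ρ t w - Lp ρ t w'| + rr ρ w + rr ρ w' →
      |Lp ρ d (c.φ w) - Lp ρ d (c.φ w')| ≤ (2 * K + 2 / e + K / e) * B →
      |Lp ρ d (c.φ w) - Lp ρ d (c.φ w')| ≤ (2 * K + 2 / e + K / e) / e ^ 3 *
        (|Lp ρ t w - Lp ρ t w'| + rr ρ w + rr ρ w') := by
    intro B h1 h2
    refine h2.trans ?_
    rw [div_mul_eq_mul_div, le_div_iff₀ (by positivity), mul_assoc]
    apply mul_le_mul_of_nonneg_left _ (by positivity)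
    linarith
  have bad : ∀ j, ¬ ((∃ l1, w = l1 ++ c.A i j z) ∧ ∃ l2, w' = l2 ++ c.X i j z) →
      e ^ 2 * rr ρ (c.A i j z) ≤ |Lp ρ t w - Lp ρ t w'| + rr ρ w + rr ρ w' := by
    intro j hj
    have pA := rr_pos hR (c.val_A (j := j) hi hz)
    have hAX := A_le_X hR he (j := j) hi hz
    have h2 : e ^ 2 * rr ρ (c.A i j z) ≤ rr ρ (c.A i j z) :=
      mul_le_of_le_one_left pA.le (pow_le_one₀ he0.le he1)
    rcases right_end hR hG hv (c.M * j) with h | h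
    · rcases left_end hR hG hv' (c.q i + c.Q * j) with h' | h'
      · exact absurd ⟨h, h'⟩ hj
      · change rr ρ (c.X i j z) ≤ Lp ρ t w' - _ + rr ρ w' at h'
        linarith
    · change rr ρ (c.A i j z) ≤ _ - Lp ρ t w at h
      linarith
  have hex : ∃ j, ¬ ((∃ l1, w = l1 ++ c.A i j z) ∧ ∃ l2, w' = l2 ++ c.X i j z) := by
    refine ⟨w.length, ?_⟩
    rintro ⟨⟨l1, h1⟩, _⟩
    have := congrArg List.length h1
    simp only [A, List.length_append, List.length_replicate, List.length_cons] at this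
    have := Nat.mul_le_mul_right w.length c.hM
    omega
  classical
  have hspec := Nat.find_spec hex
  have hmin := fun j => Nat.find_min hex (m := j)
  generalize Nat.find hex = j at hspec hmin
  have hb := bad j hspec
  cases j with
  | zero =>
    apply red (rr ρ z)
    · have := mul_le_mul_of_nonneg_left (A_zero hR he hi hz) (sq_nonneg e)
      nlinarith
    · have t1 := tel (l ++ [i]) z (by simpa using hv)
      have t2 := tel (l' ++ [i + 1]) z (by simpa using hv')
      rw [List.append_assoc, List.singleton_append] at t1 t2
      have t3 : |Lp ρ d (c.φ w) - Lp ρ d (c.φ w')| ≤ 2 * K * rr ρ z := by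
        rw [abs_le] at *
        constructor <;> linarith
      refine t3.trans (mul_le_mul_of_nonneg_right ?_ (rr_pos hR hz).le)
      have : 0 ≤ 2 / e + K / e := by positivity
      linarith
  | succ j =>
    have hg := not_not.1 (hmin j (by omega))
    obtain ⟨⟨l1, h1⟩, l2, h2⟩ := hg
    have pA := rr_pos hR (c.val_A (j := j) hi hz)
    apply red (rr ρ (c.A i j z))
    · have := mul_le_mul_of_nonneg_left (A_succ hR he (j := j) hi hz) (sq_nonneg e)
      nlinarith
    · have t1 := tel l1 (c.A i j z) (h1 ▸ hv)
      have t2 := tel l2 (c.X i j z) (h2 ▸ hv')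
      rw [← h1] at t1
      rw [← h2] at t2
      have t3 := dust_XA hR hD he (j := j) hi hz
      have t4 : K * rr ρ (c.X i j z) ≤ K / e * rr ρ (c.A i j z) := by
        rw [div_mul_eq_mul_div, le_div_iff₀ he0, mul_assoc]
        apply mul_le_mul_of_nonneg_left _ hK
        have := X_le_A hR he (j := j) hi hz
        linarith
      have t5 := mul_nonneg hK pA.le
      have t6 : (2 * K + 2 / e + K / e) * rr ρ (c.A i j z) = 2 * (K * rr ρ (c.A i j z)) +
        2 / e * rr ρ (c.A i j z) + K / e * rr ρ (c.A i j z) := by ring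
      rw [t6]
      rw [abs_le] at *
      constructor <;> linarith

theorem bound2 (hR : c.Rat ρ) {d : ℕ → ℝ} (hD : c.Geo ρ d) (hG : c.TGeo ρ t)
    (hnt : ∀ i, i + 1 < c.n → ¬ c.tch i → t i + ρ i < t (i + 1)) :
    ∃ C : ℝ, 0 ≤ C ∧ ∀ v v', c.Val v → c.Val v' →
      |Lp ρ d (c.φ v) - Lp ρ d (c.φ v')| ≤ C * (|Lp ρ t v - Lp ρ t v'| + rr ρ v + rr ρ v') := by
  classical
  obtain ⟨e, he⟩ := exists_low hR
  obtain ⟨m, _, hm1, hm⟩ := exists_max hR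
  have he0 := he.pos
  have h1m : 0 < 1 - m := by linarith
  obtain ⟨g1, hg1, hg1'⟩ := exists_lower (c.n - 1)
    (fun i => if c.tch i then 1 else t (i + 1) - t i - ρ i) (fun i hi => by
      split_ifs with h
      · norm_num
      · have := hnt i (by omega) h
        linarith)
  have hgap : ∀ b b', b < b' → b' < c.n → ¬ (c.tch b ∧ b' = b + 1) →
      min g1 e ≤ t b' - t b - ρ b := by
    intro b b' h1 h2 h3
    by_cases hb : b' = b + 1
    · subst hb
      have hnb : ¬ c.tch b := fun h => h3 ⟨h, rfl⟩
      have := hg1' b (by omega)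
      rw [if_neg hnb] at this
      exact (min_le_left _ _).trans this
    · have a1 := hG.ord b (b + 1) (by omega) (by omega)
      have a2 := hG.ord (b + 1) b' (by omega) (by omega)
      have a3 := he.lr (b + 1) (by omega)
      have a4 := min_le_right g1 e
      linarith
  have hg0 : 0 < min g1 e := lt_min hg1 he0
  generalize min g1 e = g at hgap hg0
  have tel := fun l z hv => telescope hR hm1 hm (h := fun v => Lp ρ d (c.φ v))
    (K := 1 + (2 / e + 1) / e ^ 2) (by positivity) (fun b w hw => dust_step hR hD he hw)
    (l := l) (z := z) hv
  have hK : 0 ≤ (1 + (2 / e + 1) / e ^ 2) / (1 - m) := by positivity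
  generalize (1 + (2 / e + 1) / e ^ 2) / (1 - m) = K at tel hK
  have c1 : 0 ≤ 2 * K / g := by positivity
  have c2 : 0 ≤ (2 * K + 2 / e + K / e) / e ^ 3 := by positivity
  refine ⟨K + (2 * K / g + (2 * K + 2 / e + K / e) / e ^ 3), by positivity,
    fun v v' hv hv' => ?_⟩
  refine combine hR (h := fun v => Lp ρ d (c.φ v)) (f := Lp ρ t) hK (by positivity) tel
    (fun l l' b b' z hb h1 h2 => ?_) hv hv'
  have p1 := rr_pos hR h1
  have p2 := rr_pos hR h2
  by_cases hh : c.tch b ∧ b' = b + 1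
  · obtain ⟨ht, rfl⟩ := hh
    refine (touch_case hR hD hG he hK tel ht h1 h2).trans
      (mul_le_mul_of_nonneg_right (by linarith) (by positivity))
  · refine (sep_case (h := fun v => Lp ρ d (c.φ v)) hR hG.toGeo hK tel hg0 h1 h2
      (hgap b b' hb (c.val_cons.1 (c.val_append.1 h2).2).1 hh)).trans
      (mul_le_mul_of_nonneg_right (by linarith) (by positivity))

/-! ### attractors -/

theorem attr_in {D : Set ℝ} (hD : D = ⋃ i ∈ Finset.range c.n, affMap ρ t i '' D) {w}
    (hw : c.Val w) : ∀ x ∈ D, Lp ρ t w + rr ρ w * x ∈ D := by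
  induction w with
  | nil => intro x hx; simpa [Lp, rr] using hx
  | cons b w ih =>
    intro x hx
    have hw' := c.val_cons.1 hw
    have h1 : affMap ρ t b x ∈ D := by
      rw [hD]
      exact Set.mem_biUnion (Finset.mem_coe.2 (Finset.mem_range.2 hw'.1)) ⟨x, hx, rfl⟩
    have h2 := ih hw'.2 _ h1
    have e1 : Lp ρ t (b :: w) + rr ρ (b :: w) * x = Lp ρ t w + rr ρ w * affMap ρ t b x := by
      simp only [Lp, rr, affMap]; ring
    rw [e1]; exact h2

theorem attr_out {D : Set ℝ} (hD : D = ⋃ i ∈ Finset.range c.n, affMap ρ t i '' D) {x}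
    (hx : x ∈ D) (k : ℕ) :
    ∃ w, c.Val w ∧ w.length = k ∧ ∃ y ∈ D, x = Lp ρ t w + rr ρ w * y := by
  induction k with
  | zero => exact ⟨[], by simp [Val], rfl, x, hx, by simp [Lp, rr]⟩
  | succ k ih =>
    obtain ⟨w, h1, h2, y, hy, h3⟩ := ih
    rw [hD] at hy
    simp only [Set.mem_iUnion, Finset.mem_range] at hy
    obtain ⟨b, hb, y', hy', rfl⟩ := hy
    refine ⟨b :: w, c.val_cons.2 ⟨hb, h1⟩, by simp [h2], y', hy', ?_⟩
    rw [h3]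
    simp only [Lp, rr, affMap]; ring

theorem rr_le_pow (hR : c.Rat ρ) {m : ℝ} (hm0 : 0 < m) (hm : ∀ b, b < c.n → ρ b ≤ m) {w}
    (hw : c.Val w) : rr ρ w ≤ m ^ w.length := by
  induction w with
  | nil => simp [rr]
  | cons b w ih =>
    have hw' := c.val_cons.1 hw
    have := ih hw'.2
    simp only [rr, List.length_cons, pow_succ']
    exact mul_le_mul (hm b hw'.1) this (rr_pos hR hw'.2).le hm0.le

theorem attr_approx (hR : c.Rat ρ) {D : Set ℝ} (hc : IsCompact D)
    (hD : D = ⋃ i ∈ Finset.range c.n, affMap ρ t i '' D) {x} (hx : x ∈ D) {ε : ℝ} (hε : 0 < ε) :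
    ∃ w, c.Val w ∧ |x - Lp ρ t w| < ε ∧ rr ρ w < ε := by
  obtain ⟨m, hm0, hm1, hm⟩ := exists_max hR
  obtain ⟨B, hB⟩ := hc.isBounded.exists_norm_le
  have hB1 : 0 < |B| + 1 := by positivity
  obtain ⟨k, hk⟩ := exists_pow_lt_of_lt_one (show 0 < ε / (|B| + 1) by positivity) hm1
  obtain ⟨w, h1, h2, y, hy, h3⟩ := attr_out hD hx k
  have hr := rr_le_pow hR hm0 hm h1
  rw [h2] at hr
  have hp := rr_pos hR h1
  have hlt : rr ρ w * (|B| + 1) < ε := by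
    rw [← lt_div_iff₀ hB1]; exact hr.trans_lt hk
  have hyB : |y| ≤ |B| + 1 := by
    have := hB y hy
    rw [Real.norm_eq_abs] at this
    linarith [le_abs_self B]
  refine ⟨w, h1, ?_, ?_⟩
  · rw [h3, add_sub_cancel_left, abs_mul, abs_of_pos hp]
    exact (mul_le_mul_of_nonneg_left hyB hp.le).trans_lt hlt
  · refine lt_of_le_of_lt ?_ hlt
    have := abs_nonneg B
    nlinarith

theorem main (hR : c.Rat ρ) {d : ℕ → ℝ} (hGD : c.Geo ρ d) (hG : c.TGeo ρ t) {g : ℝ} (hg0 : 0 < g)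
    (hg : ∀ b b', b < b' → b' < c.n → g ≤ d b' - d b - ρ b)
    (hnt : ∀ i, i + 1 < c.n → ¬ c.tch i → t i + ρ i < t (i + 1))
    {D T : Set ℝ} (cD : IsCompact D) (cT : IsCompact T) (nD : D.Nonempty) (nT : T.Nonempty)
    (hD : D = ⋃ i ∈ Finset.range c.n, affMap ρ d i '' D)
    (hT : T = ⋃ i ∈ Finset.range c.n, affMap ρ t i '' T) : LipEquivOn D T := by
  obtain ⟨C1, hC1, B1⟩ := bound1 hR hGD hG hg0 hg
  obtain ⟨C2, hC2, B2⟩ := bound2 hR hGD hG hnt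
  obtain ⟨x0, hx0⟩ := nD
  obtain ⟨y0, hy0⟩ := nT
  have hx := abs_nonneg x0
  have hy := abs_nonneg y0
  have mono : ∀ {a b s : ℝ}, 0 ≤ s → a ≤ b → a * s ≤ b * s :=
    fun hs hab => mul_le_mul_of_nonneg_right hab hs
  refine rough (I := {v : List ℕ // c.Val v}) cD.isClosed cT.isClosed
    (d := fun v => Lp ρ d v.1) (t := fun v => Lp ρ t (c.ψ v.1)) (s := fun v => rr ρ v.1)
    (C := 1 + C1 + C2 + |x0| + |y0|) (by linarith) ?_ ?_ ?_ ?_ ?_ ?_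
  · intro x hx ε hε
    obtain ⟨w, h1, h2, h3⟩ := attr_approx hR cD hD hx hε
    exact ⟨⟨w, h1⟩, h2, h3⟩
  · intro x hx ε hε
    obtain ⟨w, h1, h2, h3⟩ := attr_approx hR cT hT hx hε
    refine ⟨⟨c.φ w, val_φ hR h1⟩, ?_, ?_⟩
    · simpa only [ψ_φ hR h1] using h2
    · simpa only [rr_φ hR h1] using h3
  · rintro ⟨v, hv⟩
    refine ⟨_, attr_in hD hv x0 hx0, ?_⟩
    have hp := rr_pos hR hv
    simp only [add_sub_cancel_left, abs_mul, abs_of_pos hp]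
    rw [mul_comm]
    exact mono hp.le (by linarith)
  · rintro ⟨v, hv⟩
    refine ⟨_, attr_in hT (c.val_ψ hv) y0 hy0, ?_⟩
    have hp := rr_pos hR hv
    simp only [rr_ψ hR, add_sub_cancel_left, abs_mul, abs_of_pos hp]
    rw [mul_comm]
    exact mono hp.le (by linarith)
  · rintro ⟨v, hv⟩ ⟨v', hv'⟩
    have p1 := rr_pos hR hv
    have p2 := rr_pos hR hv'
    exact (B1 v v' hv hv').trans (mono (by positivity) (by linarith))
  · rintro ⟨v, hv⟩ ⟨v', hv'⟩
    have p1 := rr_pos hR hv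
    have p2 := rr_pos hR hv'
    have := B2 _ _ (c.val_ψ hv) (c.val_ψ hv')
    rw [c.φ_ψ, c.φ_ψ, rr_ψ hR, rr_ψ hR] at this
    exact this.trans (mono (by positivity) (by linarith))

end Ctx
end LipT

/-! ## Number theory of the ratios -/

namespace LipT

theorem exists_exponents {n : ℕ} {ρ : ℕ → ℝ} (hρ : ContractionVec n ρ)
    (hlog : ∀ i, i < n → ∀ j, j < n →
      ∃ q : ℚ, Real.log (ρ i) / Real.log (ρ j) = (q : ℝ)) :
    ∃ (M : ℕ) (e : ℕ → ℕ), 1 ≤ M ∧ (∀ i, 1 ≤ e i) ∧ ∀ i, i < n → ρ i ^ M = ρ 0 ^ e i := by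
  have h3 := hρ.three_le
  have hl : ∀ i, i < n → Real.log (ρ i) < 0 := fun i hi =>
    Real.log_neg (hρ.pos i hi) (hρ.lt_one i hi)
  have h1 : ∀ i, ∃ k a : ℕ, 1 ≤ k ∧ 1 ≤ a ∧ (i < n → ρ i ^ k = ρ 0 ^ a) := by
    intro i
    by_cases hi : i < n
    · obtain ⟨q, hq⟩ := hlog i hi 0 (by omega)
      have l0 := hl 0 (by omega)
      have li := hl i hi
      have hqp : 0 < q := by
        have : (0 : ℝ) < (q : ℝ) := by rw [← hq]; exact div_pos_of_neg_of_neg li l0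
        exact_mod_cast this
      have hnum : 0 < q.num := Rat.num_pos.2 hqp
      refine ⟨q.den, q.num.toNat, q.den_pos, by omega, fun _ => ?_⟩
      have e1 : (q.den : ℝ) * (q : ℝ) = (q.num.toNat : ℝ) := by
        have h2 : (q.den : ℚ) * q = (q.num.toNat : ℚ) := by
          rw [mul_comm, Rat.mul_den_eq_num]
          have h4 : ((q.num.toNat : ℤ) : ℚ) = (q.num : ℚ) := by
            rw [Int.toNat_of_nonneg hnum.le]
          rw [← h4, Int.cast_natCast]
        exact_mod_cast h2
      rw [div_eq_iff l0.ne] at hq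
      have p0 := hρ.pos 0 (by omega)
      have pi := hρ.pos i hi
      apply Real.log_injOn_pos (Set.mem_Ioi.2 (pow_pos pi _)) (Set.mem_Ioi.2 (pow_pos p0 _))
      rw [Real.log_pow, Real.log_pow, hq, ← e1]; ring
    · exact ⟨1, 1, le_rfl, le_rfl, fun h => absurd h hi⟩
  choose k a hk ha h using h1
  have hdvd : ∀ i, i < n → ∃ s, (∏ j ∈ Finset.range n, k j) = k i * s := fun i hi =>
    Finset.dvd_prod_of_mem k (Finset.mem_range.2 hi)
  have hM : 1 ≤ ∏ j ∈ Finset.range n, k j := Nat.succ_le_of_lt (Finset.prod_pos fun j _ => hk j)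
  have h2 : ∀ i, ∃ e, 1 ≤ e ∧ (i < n → ρ i ^ (∏ j ∈ Finset.range n, k j) = ρ 0 ^ e) := by
    intro i
    by_cases hi : i < n
    · obtain ⟨s, hs⟩ := hdvd i hi
      refine ⟨a i * s, ?_, fun _ => ?_⟩
      · have : s ≠ 0 := by rintro rfl; omega
        exact Nat.mul_pos (ha i) (by omega)
      · rw [hs, pow_mul, h i hi, pow_mul]
    · exact ⟨1, le_rfl, fun h => absurd h hi⟩
  choose e he1 he2 using h2
  exact ⟨_, e, hM, he1, he2⟩

theorem sum_of_step {n : ℕ} {ρ t : ℕ → ℝ} (h : ∀ i, i + 1 < n → t i + ρ i = t (i + 1)) :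
    ∀ k, k < n → t k = t 0 + ∑ i ∈ Finset.range k, ρ i := by
  intro k
  induction k with
  | zero => simp
  | succ k ih =>
    intro hk
    rw [Finset.sum_range_succ, ← h k hk, ih (by omega)]; ring

theorem chain {n : ℕ} {ρ t : ℕ → ℝ} (hp : ∀ i, i < n → 0 < ρ i) {g : ℝ} (hg : 0 ≤ g)
    (h : ∀ i, i + 1 < n → g ≤ t (i + 1) - t i - ρ i) :
    ∀ b b', b < b' → b' < n → g ≤ t b' - t b - ρ b := by
  intro b b' hb
  induction b', hb using Nat.le_induction with
  | base => intro hn; exact h b hn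
  | succ k hk ih =>
    intro hn
    have h1 := ih (by omega)
    have h2 := h k hn
    have h3 := hp k (by omega)
    linarith

end LipT

/-- Theorem 1.4: if `log ρᵢ / log ρⱼ ∈ ℚ` for all `i, j`, then `D ∼ T`. -/
theorem lipEquiv_of_all_log_ratios_rational {n : ℕ} {ρ : ℕ → ℝ}
    (hρ : ContractionVec n ρ) (S : TouchingIFS n ρ) (Q : DustIFS n ρ)
    (hlog : ∀ i, i < n → ∀ j, j < n →
      ∃ q : ℚ, Real.log (ρ i) / Real.log (ρ j) = (q : ℝ)) :
    LipEquivOn Q.D S.T := by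
  obtain ⟨M, e, hM, he, hMe⟩ := LipT.exists_exponents hρ hlog
  have h3 := hρ.three_le
  have t00 : S.t 0 = 0 := by have := S.left0; simpa [affMap] using this
  have t1 : S.t (n - 1) + ρ (n - 1) = 1 := by
    have := S.right1; simp only [affMap] at this; linarith
  have d00 : Q.d 0 = 0 := by have := Q.left0; simpa [affMap] using this
  have d1 : Q.d (n - 1) + ρ (n - 1) = 1 := by
    have := Q.right1; simp only [affMap] at this; linarith
  have tch_iff : ∀ i, S.touch i ↔ i + 1 < n ∧ S.t i + ρ i = S.t (i + 1) := by
    intro i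
    simp only [TouchingIFS.touch, affMap, mul_one, mul_zero, zero_add]
    rw [add_comm (ρ i)]
  have tord : ∀ i, i + 1 < n → S.t i + ρ i ≤ S.t (i + 1) := by
    intro i hi
    have := S.order i hi
    simp only [affMap] at this; linarith
  obtain ⟨a, ha, hat⟩ : ∃ a, a + 1 < n ∧ ¬ S.touch a := by
    by_contra! hcon
    have := LipT.sum_of_step (n := n) (ρ := ρ) (t := S.t)
      (fun i hi => ((tch_iff i).1 (hcon i hi)).2) (n - 1) (by omega)
    have hs := hρ.sum_lt
    obtain ⟨k, rfl⟩ : ∃ k, n = k + 1 := ⟨n - 1, by omega⟩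
    rw [Finset.sum_range_succ] at hs
    simp only [Nat.add_sub_cancel] at this t1
    linarith
  have tord' := LipT.chain (n := n) (t := S.t) hρ.pos le_rfl
    (fun i hi => by have := tord i hi; linarith)
  have hgpos : 0 < (1 - ∑ j ∈ Finset.range n, ρ j) / ((n : ℝ) - 1) := by
    have h3' : (3 : ℝ) ≤ n := by exact_mod_cast h3
    apply div_pos
    · have := hρ.sum_lt; linarith
    · linarith
  have dord' := LipT.chain (n := n) (t := Q.d) hρ.pos hgpos.le
    (fun i hi => by
      have := Q.equal_gap i hi
      simp only [affMap] at this; linarith)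
  have geo : ∀ t : ℕ → ℝ, t 0 = 0 → t (n - 1) + ρ (n - 1) = 1 →
      (∀ b b', b < b' → b' < n → 0 ≤ t b' - t b - ρ b) →
      (∀ b, b < n → 0 ≤ t b) ∧ ∀ b, b < n → t b + ρ b ≤ 1 := by
    intro t z0 z1 ord
    constructor
    · intro b hb
      rcases Nat.eq_zero_or_pos b with rfl | h
      · exact z0.ge
      · have := ord 0 b h hb
        have := hρ.pos 0 (by omega)
        linarith
    · intro b hb
      by_cases h : b = n - 1
      · subst h; exact z1.le
      · have := ord b (n - 1) (by omega) (by omega)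
        have := hρ.pos (n - 1) (by omega)
        linarith
  let c : LipT.Ctx :=
    { n := n
      α := a + 1
      M := M
      Q := e (n - 1)
      q := fun i => e i + 3 * e (a + 1)
      tch := S.touch
      hM := hM
      hQ := he _
      hq := fun i => by have := he i; omega
      hα0 := by omega
      hαn := ha
      htn := fun i hi => hi.1
      htα := fun i hi h => hat (by
        have : i = a := by omega
        exact this ▸ hi) }
  have hR : c.Rat ρ :=
    { pos := hρ.pos
      lt1 := hρ.lt_one
      eQ := hMe (n - 1) (by omega)
      eq := fun i hi => by
        change ρ i ^ M * ρ (a + 1) ^ (3 * M) = ρ 0 ^ (e i + 3 * e (a + 1))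
        have hi' : i + 1 < n := hi.1
        rw [hMe i (by omega), mul_comm 3 M, pow_mul, hMe (a + 1) ha, pow_add,
          mul_comm 3, pow_mul] }
  have g1 := geo Q.d d00 d1 (fun b b' h h' => hgpos.le.trans (dord' b b' h h'))
  have g2 := geo S.t t00 t1 tord'
  have hGD : c.Geo ρ Q.d := ⟨g1.1, g1.2⟩
  have hGT : c.TGeo ρ S.t :=
    { t0 := g2.1
      t1 := g2.2
      z0 := t00
      z1 := t1
      ord := fun b b' h h' => by have := tord' b b' h h'; linarith
      tt := fun i hi => (((tch_iff i).1 hi).2).symm }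
  refine LipT.Ctx.main hR hGD hGT hgpos dord' ?_ Q.compactD S.compactT Q.nonemptyD S.nonemptyT
    Q.invD S.invT
  intro i hi hni
  exact lt_of_le_of_ne (tord i hi) (fun h => hni ((tch_iff i).2 ⟨hi, h⟩))
end
end

section
/- Assume (1) log ρᵢ / log ρⱼ ∈ ℚ for all i,j ∈ {1,n,α} ∪ (Σ_T + 1). Then every touching letter i ∈ Σ_T is right substitutable: there exist u,v,w ∈ ℤ⁺ with ρ_α^u = ρₙ^v = ρ_{i+1}^w, and taking k = 2v, k' = 0 and j = i[i+1]^{w−1}[α]^u yields ρᵢ·ρₙ^k = ρ_{i+1}·ρₙ^{k'}·ρ_j with the last letter α of j not in {n} ∪ Σ_T. -/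
noncomputable section

open Set Metric MeasureTheory

variable {n : ℕ} {ρ : ℕ → ℝ}

/-- Rational log ratio of two numbers in `(0,1)` gives a common power. -/
theorem common_power_of_log_rational {a b : ℝ} (ha : 0 < a) (ha1 : a < 1) (hb : 0 < b)
    (hb1 : b < 1) (q : ℚ) (hq : Real.log a / Real.log b = (q : ℝ)) :
    ∃ p r : ℕ, 1 ≤ p ∧ 1 ≤ r ∧ a ^ p = b ^ r := by
  have la := Real.log_neg ha ha1
  have lb := Real.log_neg hb hb1
  have hqpos : 0 < q := by
    have h : (0 : ℝ) < (q : ℝ) := hq ▸ div_pos_of_neg_of_neg la lb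
    exact_mod_cast h
  have hnum : 0 < q.num := Rat.num_pos.mpr hqpos
  have hden : 0 < q.den := q.den_pos
  refine ⟨q.den, q.num.toNat, hden, by omega, ?_⟩
  have hd : (q.den : ℝ) ≠ 0 := by exact_mod_cast hden.ne'
  have hc : ((q.num.toNat : ℕ) : ℝ) = (q.num : ℝ) := by
    exact_mod_cast congrArg (Int.cast : ℤ → ℝ) (Int.toNat_of_nonneg hnum.le)
  have key : (q.den : ℝ) * Real.log a = (q.num.toNat : ℝ) * Real.log b := by
    rw [hc]
    rw [Rat.cast_def, div_eq_div_iff lb.ne hd] at hq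
    linarith
  apply Real.log_injOn_pos (Set.mem_Ioi.mpr (pow_pos ha _)) (Set.mem_Ioi.mpr (pow_pos hb _))
  rw [Real.log_pow, Real.log_pow, key]

/-- Corollary 1.3 (1): if `log ρᵢ / log ρⱼ ∈ ℚ` for all
`i, j ∈ {1, n, α} ∪ (Σ_T + 1)`, then every touching letter is right substitutable,
witnessed by `u, v, w` with `ρ_α^u = ρₙ^v = ρ_{i+1}^w`, `k = 2v`, `k' = 0` and
`j = i (i+1)^{w-1} α^u` (whose last letter `α` is not in `{n} ∪ Σ_T`). -/
theorem right_substitutable_of_log_rational {n : ℕ} {ρ : ℕ → ℝ}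
    (hρ : ContractionVec n ρ) (S : TouchingIFS n ρ)
    (α : ℕ) (hα : S.alphaRun α)
    (hlog : ∀ i ∈ ({0, n - 1, α - 1} : Set ℕ) ∪ {m | ∃ ℓ, S.touch ℓ ∧ m = ℓ + 1},
            ∀ j ∈ ({0, n - 1, α - 1} : Set ℕ) ∪ {m | ∃ ℓ, S.touch ℓ ∧ m = ℓ + 1},
            ∃ q : ℚ, Real.log (ρ i) / Real.log (ρ j) = (q : ℝ)) :
    ∀ i, S.touch i → ∃ u v w : ℕ, 1 ≤ u ∧ 1 ≤ v ∧ 1 ≤ w ∧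
      ρ (α - 1) ^ u = ρ (n - 1) ^ v ∧ ρ (n - 1) ^ v = ρ (i + 1) ^ w ∧
      ρ i * ρ (n - 1) ^ (2 * v) = ρ (i + 1) * ρ (n - 1) ^ (0 : ℕ) *
        (([i] ++ List.replicate (w - 1) (i + 1) ++ List.replicate u (α - 1)).map ρ).prod ∧
      α - 1 ≠ n - 1 ∧ ¬ S.touch (α - 1) := by
  intro i hi
  obtain ⟨hα1, hαn, -, hαt⟩ := hα
  have hn := hρ.three_le
  have mn : n - 1 ∈ ({0, n - 1, α - 1} : Set ℕ) ∪ {m | ∃ ℓ, S.touch ℓ ∧ m = ℓ + 1} := by simp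
  have mα : α - 1 ∈ ({0, n - 1, α - 1} : Set ℕ) ∪ {m | ∃ ℓ, S.touch ℓ ∧ m = ℓ + 1} := by simp
  have mi : i + 1 ∈ ({0, n - 1, α - 1} : Set ℕ) ∪ {m | ∃ ℓ, S.touch ℓ ∧ m = ℓ + 1} :=
    Or.inr ⟨i, hi, rfl⟩
  have ln : n - 1 < n := by omega
  have lα : α - 1 < n := by omega
  have li : i + 1 < n := hi.1
  obtain ⟨q, hq⟩ := hlog _ mα _ mn
  obtain ⟨q', hq'⟩ := hlog _ mi _ mn
  obtain ⟨p, r, hp, hr, e⟩ := common_power_of_log_rational (hρ.pos _ lα) (hρ.lt_one _ lα)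
    (hρ.pos _ ln) (hρ.lt_one _ ln) q hq
  obtain ⟨p', r', hp', hr', e'⟩ := common_power_of_log_rational (hρ.pos _ li) (hρ.lt_one _ li)
    (hρ.pos _ ln) (hρ.lt_one _ ln) q' hq'
  have hw : 1 ≤ p' * r := Nat.mul_pos hp' hr
  have e1 : ρ (α - 1) ^ (p * r') = ρ (n - 1) ^ (r * r') := by rw [pow_mul, e, ← pow_mul]
  have e2 : ρ (n - 1) ^ (r * r') = ρ (i + 1) ^ (p' * r) := by
    rw [pow_mul _ p' r, e', ← pow_mul, mul_comm]
  refine ⟨p * r', r * r', p' * r, Nat.mul_pos hp hr', Nat.mul_pos hr hr', hw, e1, e2, ?_,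
    by omega, hαt⟩
  have e3 : ρ (i + 1) * ρ (i + 1) ^ (p' * r - 1) = ρ (n - 1) ^ (r * r') := by
    rw [← pow_succ', Nat.sub_add_cancel hw, e2]
  simp only [List.map_append, List.map_cons, List.map_nil, List.map_replicate, List.prod_append,
    List.prod_cons, List.prod_nil, List.prod_replicate, e1]
  rw [two_mul, pow_add]
  nth_rewrite 1 [← e3]
  ring
end
end

section
/- In the setup with n = 4, ρ₁ = ρ₄, Σ_T = {2}, define E_k = T_{2[4]^k} ∪ T_{3[1]^k} for k ≥ 0, ℰ₁ = {T₁, T₄, E₀}, and ℰ_{k+1} = Ψ₁(ℰ_k) ∪ Ψ₄(ℰ_k) ∪ (Ψ₂(ℰ_k)∖{T_{2[4]^k}}) ∪ (Ψ₃(ℰ_k)∖{T_{3[1]^k}}) ∪ {E_k}. Then with μᵢ = ρᵢ^s (s the Hausdorff dimension), for all k ≥ 1: { ℋ^s(A)/ℋ^s(B) : A ∈ ℰ_{k+1}, B ∈ ℰ_k, A ⊆ B } = { μ₁, μ₂, μ₃, μ₂+μ₃, μ₁μ₂/(μ₂+μ₃), μ₁μ₃/(μ₂+μ₃) }. -/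
noncomputable section

open Set Metric MeasureTheory

variable {n : ℕ} {ρ : ℕ → ℝ}

/-- Geometric facts about the IFS. -/
structure Geo (ρ t : ℕ → ℝ) (T : Set ℝ) (s : ℝ) : Prop where
  pos : ∀ i, i < 4 → 0 < ρ i
  lt1 : ∀ i, i < 4 → ρ i < 1
  t0 : t 0 = 0
  g0 : ρ 0 < t 1
  t12 : ρ 1 + t 1 = t 2
  g2 : ρ 2 + t 2 < t 3
  t3 : ρ 3 + t 3 = 1
  nn : ∀ x ∈ T, 0 ≤ x
  le1 : ∀ x ∈ T, x ≤ 1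
  zero : (0:ℝ) ∈ T
  one : (1:ℝ) ∈ T
  cpt : IsCompact T
  dec : ∀ x ∈ T, ∃ i, i < 4 ∧ ∃ y ∈ T, x = ρ i * y + t i
  inc : ∀ i, i < 4 → ∀ x ∈ T, ρ i * x + t i ∈ T
  s0 : 0 < s
  hs : ρ 0 ^ s + ρ 1 ^ s + ρ 2 ^ s + ρ 3 ^ s = 1

theorem geo_of {ρ : ℕ → ℝ} (hρ : ContractionVec 4 ρ) (S : TouchingIFS 4 ρ)
    (htouch : S.touch 1) (hnt0 : ¬ S.touch 0) (hnt2 : ¬ S.touch 2)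
    (s : ℝ) (hs : (∑ i ∈ Finset.range 4, ρ i ^ s) = 1) : Geo ρ S.t S.T s := by
  have hpos := hρ.pos
  have hlt := hρ.lt_one
  have o0 := S.order 0 (by norm_num)
  have o1 := htouch.2
  have o2 := S.order 2 (by norm_num)
  have l0 := S.left0
  have r1 := S.right1
  have n0 : affMap ρ S.t 0 1 ≠ affMap ρ S.t (0+1) 0 := fun h => hnt0 ⟨by norm_num, h⟩
  have n2 : affMap ρ S.t 2 1 ≠ affMap ρ S.t (2+1) 0 := fun h => hnt2 ⟨by norm_num, h⟩
  have o0' := lt_of_le_of_ne o0 n0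
  have o2' := lt_of_le_of_ne o2 n2
  simp only [affMap] at o0' o1 o2' l0 r1
  norm_num at o0' o1 o2' l0 r1
  have p0 := hpos 0 (by norm_num)
  have p1 := hpos 1 (by norm_num)
  have p2 := hpos 2 (by norm_num)
  have p3 := hpos 3 (by norm_num)
  have tnn : ∀ i, i < 4 → 0 ≤ S.t i := by
    intro i hi
    interval_cases i <;> linarith
  have tle : ∀ i, i < 4 → ρ i + S.t i ≤ 1 := by
    intro i hi
    interval_cases i <;> linarith
  have dec : ∀ x ∈ S.T, ∃ i, i < 4 ∧ ∃ y ∈ S.T, x = ρ i * y + S.t i := by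
    intro x hx
    rw [S.invT] at hx
    simp only [Set.mem_iUnion, Finset.mem_range] at hx
    obtain ⟨i, hi, y, hy, rfl⟩ := hx
    exact ⟨i, hi, y, hy, rfl⟩
  have inc : ∀ i, i < 4 → ∀ x ∈ S.T, ρ i * x + S.t i ∈ S.T := by
    intro i hi x hx
    rw [S.invT]
    simp only [Set.mem_iUnion, Finset.mem_range]
    exact ⟨i, hi, x, hx, rfl⟩
  obtain ⟨M, hM, hMle⟩ := S.compactT.exists_isGreatest S.nonemptyT
  obtain ⟨m, hm, hmle⟩ := S.compactT.exists_isLeast S.nonemptyT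
  have hMle1 : M ≤ 1 := by
    obtain ⟨i, hi, y, hy, h⟩ := dec M hM
    have h1 := hMle hy
    have h2 := tle i hi
    have h3 := hpos i hi
    have h4 := hlt i hi
    nlinarith
  have hm0 : 0 ≤ m := by
    obtain ⟨i, hi, y, hy, h⟩ := dec m hm
    have h1 := hmle hy
    have h2 := tnn i hi
    have h3 := hpos i hi
    have h4 := hlt i hi
    nlinarith
  have hM1 : M = 1 := by
    have h := hMle (inc 3 (by norm_num) M hM)
    have h4 := hlt 3 (by norm_num)
    nlinarith
  have hm1 : m = 0 := by
    have h := hmle (inc 0 (by norm_num) m hm)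
    have h4 := hlt 0 (by norm_num)
    nlinarith
  have hs' : ρ 0 ^ s + ρ 1 ^ s + ρ 2 ^ s + ρ 3 ^ s = 1 := by
    simpa [Finset.sum_range_succ] using hs
  refine ⟨hpos, hlt, l0, by linarith, o1, o2', r1, fun x hx => hm0.trans (hmle hx),
    fun x hx => (hMle hx).trans hMle1, hm1 ▸ hm, hM1 ▸ hM, S.compactT, dec, inc, ?_, hs'⟩
  by_contra hneg
  push Not at hneg
  have h1 : 1 ≤ ρ 0 ^ s := Real.one_le_rpow_of_pos_of_le_one_of_nonpos p0 (hlt 0 (by norm_num)).le hneg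
  have h2 : 0 < ρ 1 ^ s := Real.rpow_pos_of_pos p1 s
  have h3 : 0 < ρ 2 ^ s := Real.rpow_pos_of_pos p2 s
  have h4 : 0 < ρ 3 ^ s := Real.rpow_pos_of_pos p3 s
  linarith

/-- Partial sums of the weights. -/
def cc (ρ : ℕ → ℝ) (s : ℝ) (i : ℕ) : ℝ := ∑ j ∈ Finset.range i, ρ j ^ s

open Classical in
/-- index of the piece. -/
def pidx (ρ t : ℕ → ℝ) (x : ℝ) : ℕ :=
  if x ≤ ρ 0 then 0 else if x ≤ t 2 then 1 else if x ≤ ρ 2 + t 2 then 2 else 3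

/-- Approximations of the distribution function. -/
def FF (ρ t : ℕ → ℝ) (s : ℝ) : ℕ → ℝ → ℝ
  | 0 => fun _ => 0
  | n + 1 => fun x => cc ρ s (pidx ρ t x) +
      ρ (pidx ρ t x) ^ s * FF ρ t s n ((x - t (pidx ρ t x)) / ρ (pidx ρ t x))

section
variable {ρ t : ℕ → ℝ} {T : Set ℝ} {s : ℝ}

theorem pidx_lt (x : ℝ) : pidx ρ t x < 4 := by
  unfold pidx; split_ifs <;> norm_num

theorem Geo.ppos (G : Geo ρ t T s) : ∀ i, i < 4 → 0 < ρ i ^ s :=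
  fun i hi => Real.rpow_pos_of_pos (G.pos i hi) s

theorem Geo.cc_nn (G : Geo ρ t T s) : ∀ i, i < 4 → 0 ≤ cc ρ s i := by
  intro i hi
  exact Finset.sum_nonneg fun j hj => (G.ppos j (by simp at hj; omega)).le

theorem Geo.cc_le (G : Geo ρ t T s) : ∀ i, i < 4 → cc ρ s i + ρ i ^ s ≤ 1 := by
  intro i hi
  have h := G.hs
  have h0 := G.ppos 0 (by norm_num)
  have h1 := G.ppos 1 (by norm_num)
  have h2 := G.ppos 2 (by norm_num)
  have h3 := G.ppos 3 (by norm_num)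
  interval_cases i <;> simp [cc, Finset.sum_range_succ] <;> linarith

theorem Geo.FF_mem (G : Geo ρ t T s) (n : ℕ) : ∀ x, 0 ≤ FF ρ t s n x ∧ FF ρ t s n x ≤ 1 := by
  induction n with
  | zero => intro x; simp [FF]
  | succ n ih =>
    intro x
    have hi := pidx_lt (ρ := ρ) (t := t) x
    have h1 := G.ppos _ hi
    have h2 := G.cc_nn _ hi
    have h3 := G.cc_le _ hi
    obtain ⟨h4, h5⟩ := ih ((x - t (pidx ρ t x)) / ρ (pidx ρ t x))
    simp only [FF]
    constructor
    · positivity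
    · nlinarith

theorem Geo.FF_mono (G : Geo ρ t T s) (x : ℝ) : Monotone (fun n => FF ρ t s n x) := by
  apply monotone_nat_of_le_succ
  intro n
  induction n generalizing x with
  | zero => exact (G.FF_mem 1 x).1
  | succ n ih =>
    have hi := pidx_lt (ρ := ρ) (t := t) x
    have h1 := G.ppos _ hi
    have := ih ((x - t (pidx ρ t x)) / ρ (pidx ρ t x))
    show cc ρ s (pidx ρ t x) + _ * FF ρ t s n _ ≤ cc ρ s (pidx ρ t x) + _ * FF ρ t s (n+1) _
    gcongr

theorem Geo.exF0 (G : Geo ρ t T s) : ∃ F : ℝ → ℝ, (∀ x, 0 ≤ F x ∧ F x ≤ 1) ∧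
    ∀ x, F x = cc ρ s (pidx ρ t x) +
      ρ (pidx ρ t x) ^ s * F ((x - t (pidx ρ t x)) / ρ (pidx ρ t x)) := by
  have key : ∀ x, ∃ y, Filter.Tendsto (fun n => FF ρ t s n x) Filter.atTop (nhds y) := fun x =>
    ⟨_, tendsto_atTop_ciSup (G.FF_mono x) ⟨1, by rintro _ ⟨n, rfl⟩; exact (G.FF_mem n x).2⟩⟩
  choose F hF using key
  refine ⟨F, fun x => ⟨ge_of_tendsto' (hF x) fun n => (G.FF_mem n x).1,
    le_of_tendsto' (hF x) fun n => (G.FF_mem n x).2⟩, fun x => ?_⟩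
  have h1 := (hF x).comp (Filter.tendsto_add_atTop_nat 1)
  have h2 := ((hF ((x - t (pidx ρ t x)) / ρ (pidx ρ t x))).const_mul (ρ (pidx ρ t x) ^ s)).const_add
    (cc ρ s (pidx ρ t x))
  exact tendsto_nhds_unique h1 h2

theorem Geo.p_lt (G : Geo ρ t T s) : ∀ i, i < 4 → ρ i ^ s < 1 :=
  fun i hi => Real.rpow_lt_one (G.pos i hi).le (G.lt1 i hi) G.s0

theorem Geo.exF (G : Geo ρ t T s) : ∃ F : ℝ → ℝ, (∀ x, 0 ≤ F x ∧ F x ≤ 1) ∧ F 0 = 0 ∧ F 1 = 1 ∧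
    ∀ i, i < 4 → ∀ x, 0 ≤ x → x ≤ 1 → F (ρ i * x + t i) = cc ρ s i + ρ i ^ s * F x := by
  obtain ⟨F, hF, hfe⟩ := G.exF0
  have p0 := G.pos 0 (by norm_num)
  have p1 := G.pos 1 (by norm_num)
  have p2 := G.pos 2 (by norm_num)
  have p3 := G.pos 3 (by norm_num)
  have t0 := G.t0
  have g0 := G.g0
  have t12 := G.t12
  have g2 := G.g2
  have t3 := G.t3
  have gen : ∀ i, i < 4 → ∀ x, pidx ρ t (ρ i * x + t i) = i →
      F (ρ i * x + t i) = cc ρ s i + ρ i ^ s * F x := by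
    intro i hi x hx
    rw [hfe, hx]
    congr 3
    have := G.pos i hi
    field_simp
    ring
  have F0 : F 0 = 0 := by
    have h := gen 0 (by norm_num) 0 (by simp [pidx, t0, p0.le])
    have := G.p_lt 0 (by norm_num)
    simp [t0, cc] at h
    nlinarith
  have F1 : F 1 = 1 := by
    have h := gen 3 (by norm_num) 1 (by
      have e : ρ 3 * 1 + t 3 = 1 := by linarith
      rw [e, pidx, if_neg (by linarith), if_neg (by linarith), if_neg (by linarith)])
    have e : ρ 3 * 1 + t 3 = 1 := by linarith
    rw [e] at h
    have := G.p_lt 3 (by norm_num)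
    have := G.hs
    simp [cc, Finset.sum_range_succ] at h
    nlinarith
  refine ⟨F, hF, F0, F1, ?_⟩
  intro i hi x hx0 hx1
  by_cases hsp : i = 2 ∧ x = 0
  · obtain ⟨rfl, rfl⟩ := hsp
    have h := gen 1 (by norm_num) 1 (by
      rw [pidx, if_neg (by linarith), if_pos (by linarith)])
    have e : ρ 1 * 1 + t 1 = ρ 2 * 0 + t 2 := by linarith
    rw [← e, h, F0, F1]
    simp [cc, Finset.sum_range_succ]
  · apply gen i hi
    interval_cases i
    · rw [pidx, if_pos (by nlinarith)]
    · rw [pidx, if_neg (by nlinarith), if_pos (by nlinarith)]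
    · have : 0 < x := lt_of_le_of_ne hx0 (by simpa [eq_comm] using hsp)
      rw [pidx, if_neg (by nlinarith), if_neg (by nlinarith), if_pos (by nlinarith)]
    · rw [pidx, if_neg (by nlinarith), if_neg (by nlinarith), if_neg (by nlinarith)]

theorem le_of_geom {a b q : ℝ} (hq0 : 0 ≤ q) (hq : q < 1) (h : ∀ n : ℕ, a ≤ b + q ^ n) : a ≤ b := by
  have := (tendsto_pow_atTop_nhds_zero_of_lt_one hq0 hq).const_add b
  rw [add_zero] at this
  exact ge_of_tendsto' this h

theorem Geo.exq (G : Geo ρ t T s) : ∃ q, 0 ≤ q ∧ q < 1 ∧ ∀ i, i < 4 → ρ i ^ s ≤ q := by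
  refine ⟨1 - min (min (ρ 0 ^ s) (ρ 1 ^ s)) (min (ρ 2 ^ s) (ρ 3 ^ s)), ?_, ?_, ?_⟩
  all_goals
    have h := G.hs
    have h0 := G.ppos 0 (by norm_num)
    have h1 := G.ppos 1 (by norm_num)
    have h2 := G.ppos 2 (by norm_num)
    have h3 := G.ppos 3 (by norm_num)
  · have : min (min (ρ 0 ^ s) (ρ 1 ^ s)) (min (ρ 2 ^ s) (ρ 3 ^ s)) ≤ ρ 0 ^ s := by simp
    linarith
  · have : 0 < min (min (ρ 0 ^ s) (ρ 1 ^ s)) (min (ρ 2 ^ s) (ρ 3 ^ s)) := by simp [*]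
    linarith
  · intro i hi
    have a0 : min (min (ρ 0 ^ s) (ρ 1 ^ s)) (min (ρ 2 ^ s) (ρ 3 ^ s)) ≤ ρ 0 ^ s := by simp
    have a1 : min (min (ρ 0 ^ s) (ρ 1 ^ s)) (min (ρ 2 ^ s) (ρ 3 ^ s)) ≤ ρ 1 ^ s := by simp
    interval_cases i <;> linarith

set_option maxHeartbeats 1600000 in
theorem Geo.hold (G : Geo ρ t T s) {F : ℝ → ℝ} (hF : ∀ x, 0 ≤ F x ∧ F x ≤ 1)
    (F0 : F 0 = 0) (F1 : F 1 = 1)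
    (hfe : ∀ i, i < 4 → ∀ x, 0 ≤ x → x ≤ 1 → F (ρ i * x + t i) = cc ρ s i + ρ i ^ s * F x) :
    ∃ C, 0 ≤ C ∧ ∀ x ∈ T, ∀ y ∈ T, x ≤ y → |F x - F y| ≤ C * (y - x) ^ s := by
  obtain ⟨q, hq0, hq1, hq⟩ := G.exq
  have p0 := G.pos 0 (by norm_num)
  have p1 := G.pos 1 (by norm_num)
  have p2 := G.pos 2 (by norm_num)
  have p3 := G.pos 3 (by norm_num)
  have t0 := G.t0
  have g0 := G.g0
  have t12 := G.t12
  have g2 := G.g2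
  have t3 := G.t3
  have hsum := G.hs
  set δ := min (t 1 - ρ 0) (t 3 - (ρ 2 + t 2)) with hδ
  have δ0 : 0 < δ := by rw [hδ]; apply lt_min <;> linarith
  have d1 : δ ≤ t 1 - ρ 0 := min_le_left _ _
  have d2 : δ ≤ t 3 - (ρ 2 + t 2) := min_le_right _ _
  clear_value δ
  set C := (δ ^ s)⁻¹ with hC
  have C0 : 0 < C := by positivity
  have hbig : ∀ u, δ ≤ u → 1 ≤ C * u ^ s := by
    intro u hu
    have : δ ^ s ≤ u ^ s := Real.rpow_le_rpow δ0.le hu G.s0.le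
    calc (1:ℝ) = C * δ ^ s := by rw [hC]; field_simp
      _ ≤ _ := by gcongr
  clear_value C
  have hsc : ∀ i, i < 4 → ∀ u, 0 ≤ u → (ρ i * u) ^ s = ρ i ^ s * u ^ s := fun i hi u hu =>
    Real.mul_rpow (G.pos i hi).le hu
  -- right endpoint
  have H1 : ∀ n : ℕ, ∀ x ∈ T, 1 - F x ≤ C * (1 - x) ^ s + q ^ n := by
    intro n
    induction n with
    | zero =>
      intro x hx
      have := hF x
      have : 0 ≤ C * (1 - x) ^ s :=
        mul_nonneg C0.le (Real.rpow_nonneg (by linarith [G.le1 x hx]) _)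
      simp; linarith
    | succ n ih =>
      intro x hx
      obtain ⟨i, hi, y, hy, rfl⟩ := G.dec x hx
      have y0 := G.nn y hy
      have y1 := G.le1 y hy
      have qn : 0 ≤ q ^ (n+1) := by positivity
      by_cases h3 : i = 3
      · subst h3
        rw [hfe 3 hi y y0 y1]
        have e : 1 - (ρ 3 * y + t 3) = ρ 3 * (1 - y) := by linarith
        rw [e, hsc 3 hi _ (by linarith)]
        have := ih y hy
        have hp := G.ppos 3 hi
        have hqi := hq 3 hi
        have e2 : 1 - (cc ρ s 3 + ρ 3 ^ s * F y) = ρ 3 ^ s * (1 - F y) := by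
          simp [cc, Finset.sum_range_succ]; linarith
        rw [e2]
        calc ρ 3 ^ s * (1 - F y) ≤ ρ 3 ^ s * (C * (1 - y) ^ s + q ^ n) := by gcongr
          _ = C * (ρ 3 ^ s * (1 - y) ^ s) + ρ 3 ^ s * q ^ n := by ring
          _ ≤ C * (ρ 3 ^ s * (1 - y) ^ s) + q * q ^ n := by gcongr
          _ = _ := by ring
      · have := hF (ρ i * y + t i)
        have := hbig (1 - (ρ i * y + t i)) (by
          interval_cases i
          · nlinarith
          · nlinarith
          · nlinarith
          · simp at h3)
        linarith
  have H0 : ∀ n : ℕ, ∀ x ∈ T, F x ≤ C * x ^ s + q ^ n := by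
    intro n
    induction n with
    | zero =>
      intro x hx
      have := hF x
      have : 0 ≤ C * x ^ s :=
        mul_nonneg C0.le (Real.rpow_nonneg (by linarith [G.nn x hx]) _)
      simp; linarith
    | succ n ih =>
      intro x hx
      obtain ⟨i, hi, y, hy, rfl⟩ := G.dec x hx
      have y0 := G.nn y hy
      have y1 := G.le1 y hy
      have qn : 0 ≤ q ^ (n+1) := by positivity
      by_cases h3 : i = 0
      · subst h3
        rw [hfe 0 hi y y0 y1]
        rw [t0, add_zero, hsc 0 hi _ (by linarith)]
        have := ih y hy
        have hp := G.ppos 0 hi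
        have hqi := hq 0 hi
        have e2 : cc ρ s 0 = 0 := by simp [cc]
        rw [e2, zero_add]
        calc ρ 0 ^ s * (F y) ≤ ρ 0 ^ s * (C * y ^ s + q ^ n) := by gcongr
          _ = C * (ρ 0 ^ s * y ^ s) + ρ 0 ^ s * q ^ n := by ring
          _ ≤ C * (ρ 0 ^ s * y ^ s) + q * q ^ n := by gcongr
          _ = _ := by ring
      · have := hF (ρ i * y + t i)
        have := hbig ((ρ i * y + t i)) (by
          interval_cases i
          · simp at h3
          · nlinarith
          · nlinarith
          · nlinarith)
        linarith
  have K1 : ∀ x ∈ T, 1 - F x ≤ C * (1 - x) ^ s := fun x hx =>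
    le_of_geom hq0 hq1 fun n => H1 n x hx
  have K0 : ∀ x ∈ T, F x ≤ C * x ^ s := fun x hx =>
    le_of_geom hq0 hq1 fun n => H0 n x hx
  have H2 : ∀ n : ℕ, ∀ x ∈ T, ∀ y ∈ T, x ≤ y → |F x - F y| ≤ 2 * C * (y - x) ^ s + q ^ n := by
    intro n
    induction n with
    | zero =>
      intro x hx y hy hxy
      have h1 := hF x
      have h2 := hF y
      have : 0 ≤ 2 * C * (y - x) ^ s :=
        mul_nonneg (by positivity) (Real.rpow_nonneg (by linarith) _)
      rw [pow_zero, abs_le]; constructor <;> linarith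
    | succ n ih =>
      intro x hx y hy hxy
      have qn : 0 ≤ q ^ (n+1) := by positivity
      have hX := hF x
      have hY := hF y
      have hnn : 0 ≤ (y - x) ^ s := Real.rpow_nonneg (by linarith) _
      have far : δ ≤ y - x → |F x - F y| ≤ 2 * C * (y - x) ^ s + q ^ (n+1) := by
        intro h
        have := hbig _ h
        have h2 : |F x - F y| ≤ 1 := by rw [abs_le]; constructor <;> linarith
        linarith
      have same : x = y → |F x - F y| ≤ 2 * C * (y - x) ^ s + q ^ (n+1) := by
        rintro rfl
        rw [sub_self, abs_zero]; positivity
      obtain ⟨i, hi, x', hx', ex⟩ := G.dec x hx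
      obtain ⟨j, hj, y', hy', ey⟩ := G.dec y hy
      have x0 := G.nn x' hx'
      have x1 := G.le1 x' hx'
      have y0 := G.nn y' hy'
      have y1 := G.le1 y' hy'
      have pi := G.pos i hi
      have pj := G.pos j hj
      have mi0 : 0 ≤ ρ i * x' := by positivity
      have mi1 : ρ i * x' ≤ ρ i := by nlinarith
      have mj0 : 0 ≤ ρ j * y' := by positivity
      have mj1 : ρ j * y' ≤ ρ j := by nlinarith
      by_cases hij : i = j
      · subst hij
        have hxy' : x' ≤ y' := by
          have : ρ i * x' ≤ ρ i * y' := by linarith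
          exact le_of_mul_le_mul_left this pi
        have hI := ih x' hx' y' hy' hxy'
        have hp := G.ppos i hi
        have hqi := hq i hi
        have e1 : y - x = ρ i * (y' - x') := by rw [ex, ey]; ring
        have e2 : F x - F y = ρ i ^ s * (F x' - F y') := by
          rw [ex, ey, hfe i hi _ x0 x1, hfe i hi _ y0 y1]; ring
        rw [e1, e2, hsc i hi _ (by linarith), abs_mul, abs_of_pos hp]
        calc ρ i ^ s * |F x' - F y'| ≤ ρ i ^ s * (2 * C * (y' - x') ^ s + q ^ n) := by gcongr
          _ = 2 * C * (ρ i ^ s * (y' - x') ^ s) + ρ i ^ s * q ^ n := by ring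
          _ ≤ 2 * C * (ρ i ^ s * (y' - x') ^ s) + q * q ^ n := by gcongr
          _ = _ := by ring
      · by_cases h12 : i = 1 ∧ j = 2
        · obtain ⟨rfl, rfl⟩ := h12
          have hp1 := G.ppos 1 hi
          have hp2 := G.ppos 2 hj
          have k1 := K1 x' hx'
          have k0 := K0 y' hy'
          have e2 : F y - F x = ρ 2 ^ s * F y' + ρ 1 ^ s * (1 - F x') := by
            rw [ex, ey, hfe 1 hi _ x0 x1, hfe 2 hj _ y0 y1]
            simp [cc, Finset.sum_range_succ]; ring
          have a1 : ρ 1 ^ s * (1 - x') ^ s ≤ (y - x) ^ s := by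
            rw [← hsc 1 hi _ (by linarith)]
            apply Real.rpow_le_rpow _ _ G.s0.le
            · nlinarith
            · nlinarith
          have a2 : ρ 2 ^ s * y' ^ s ≤ (y - x) ^ s := by
            rw [← hsc 2 hj _ (by linarith)]
            apply Real.rpow_le_rpow _ _ G.s0.le
            · nlinarith
            · nlinarith
          have nn2 : 0 ≤ F y - F x := by
            rw [e2]
            have := hF x'
            have := hF y'
            have : 0 ≤ 1 - F x' := by linarith
            have : 0 ≤ F y' := by linarith
            positivity
          rw [abs_sub_comm, abs_of_nonneg nn2, e2]
          calc ρ 2 ^ s * F y' + ρ 1 ^ s * (1 - F x')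
              ≤ ρ 2 ^ s * (C * y' ^ s) + ρ 1 ^ s * (C * (1 - x') ^ s) := by gcongr
            _ = C * (ρ 2 ^ s * y' ^ s) + C * (ρ 1 ^ s * (1 - x') ^ s) := by ring
            _ ≤ C * (y - x) ^ s + C * (y - x) ^ s := by gcongr
            _ ≤ _ := by linarith
        · interval_cases i <;> interval_cases j <;> first
            | (exfalso; simp at hij h12; done)
            | (apply far; linarith)
            | (apply same; linarith)
  exact ⟨2 * C, by positivity, fun x hx y hy hxy => le_of_geom hq0 hq1 fun n => H2 n x hx y hy hxy⟩

theorem Geo.dens (G : Geo ρ t T s) {F : ℝ → ℝ} (hF : ∀ x, 0 ≤ F x ∧ F x ≤ 1)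
    {q : ℝ} (hq0 : 0 ≤ q) (hq : ∀ i, i < 4 → ρ i ^ s ≤ q)
    (hfe : ∀ i, i < 4 → ∀ x, 0 ≤ x → x ≤ 1 → F (ρ i * x + t i) = cc ρ s i + ρ i ^ s * F x)
    (n : ℕ) : ∀ y, 0 ≤ y → y ≤ 1 → ∃ x ∈ T, |F x - y| ≤ q ^ n := by
  induction n with
  | zero =>
    intro y hy0 hy1
    refine ⟨0, G.zero, ?_⟩
    have := hF 0
    rw [pow_zero, abs_le]; constructor <;> linarith
  | succ n ih =>
    intro y hy0 hy1
    have : ∃ i, i < 4 ∧ cc ρ s i ≤ y ∧ y ≤ cc ρ s i + ρ i ^ s := by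
      have hsum := G.hs
      by_cases h1 : y ≤ ρ 0 ^ s
      · exact ⟨0, by norm_num, by simpa [cc] using hy0, by simpa [cc] using h1⟩
      by_cases h2 : y ≤ ρ 0 ^ s + ρ 1 ^ s
      · exact ⟨1, by norm_num, by simp [cc]; linarith, by simpa [cc] using h2⟩
      by_cases h3 : y ≤ ρ 0 ^ s + ρ 1 ^ s + ρ 2 ^ s
      · exact ⟨2, by norm_num, by simp [cc, Finset.sum_range_succ]; linarith,
          by simpa [cc, Finset.sum_range_succ] using h3⟩
      · exact ⟨3, by norm_num, by simp [cc, Finset.sum_range_succ]; linarith,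
          by simp [cc, Finset.sum_range_succ]; linarith⟩
    obtain ⟨i, hi, h1, h2⟩ := this
    have hp := G.ppos i hi
    obtain ⟨x, hx, hxy⟩ := ih ((y - cc ρ s i) / ρ i ^ s) (div_nonneg (by linarith) hp.le)
      (by rw [div_le_one hp]; linarith)
    refine ⟨ρ i * x + t i, G.inc i hi x hx, ?_⟩
    rw [hfe i hi x (G.nn x hx) (G.le1 x hx)]
    have e : cc ρ s i + ρ i ^ s * F x - y = ρ i ^ s * (F x - (y - cc ρ s i) / ρ i ^ s) := by
      field_simp; ring
    rw [e, abs_mul, abs_of_pos hp, pow_succ, mul_comm]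
    have := hq i hi
    gcongr

theorem Geo.pos_meas (G : Geo ρ t T s) : μH[s] T ≠ 0 := by
  obtain ⟨F, hF, F0, F1, hfe⟩ := G.exF
  obtain ⟨q, hq0, hq1, hq⟩ := G.exq
  obtain ⟨C, hC, hH⟩ := G.hold hF F0 F1 hfe
  have hH' : ∀ x ∈ T, ∀ y ∈ T, |F x - F y| ≤ C * |x - y| ^ s := by
    intro x hx y hy
    rcases le_total x y with h | h
    · rw [abs_sub_comm x y, abs_of_nonneg (sub_nonneg.2 h)]; exact hH x hx y hy h
    · rw [abs_sub_comm (F x), abs_of_nonneg (sub_nonneg.2 h)]; exact hH y hy x hx h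
  have hold : HolderOnWith C.toNNReal s.toNNReal F T := by
    intro x hx y hy
    rw [edist_dist, edist_dist, Real.coe_toNNReal s G.s0.le,
      ENNReal.ofReal_rpow_of_nonneg dist_nonneg G.s0.le]
    change _ ≤ ENNReal.ofReal C * _
    rw [← ENNReal.ofReal_mul hC]
    exact ENNReal.ofReal_le_ofReal (hH' x hx y hy)
  have hs0 : 0 < s.toNNReal := Real.toNNReal_pos.2 G.s0
  have hcont : ContinuousOn F T := hold.continuousOn hs0
  have hclosed : IsClosed (F '' T) := (G.cpt.image_of_continuousOn hcont).isClosed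
  have hsub : Set.Icc (0:ℝ) 1 ⊆ F '' T := by
    intro y hy
    rw [← hclosed.closure_eq, Metric.mem_closure_iff]
    intro ε hε
    obtain ⟨n, hn⟩ := exists_pow_lt_of_lt_one hε hq1
    obtain ⟨x, hx, hxy⟩ := G.dens hF hq0 hq hfe n y hy.1 hy.2
    refine ⟨F x, ⟨x, hx, rfl⟩, ?_⟩
    rw [dist_comm, Real.dist_eq]
    linarith
  intro h0
  have h := hold.hausdorffMeasure_image_le hs0 (zero_le_one (α := ℝ))
  rw [mul_one, Real.coe_toNNReal s G.s0.le, h0, mul_zero, hausdorffMeasure_real] at h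
  have h2 := (measure_mono (μ := volume) hsub).trans h
  simp at h2

theorem Geo.fin_meas (G : Geo ρ t T s) : μH[s] T ≠ ⊤ := by
  have hdiam : ∀ n : ℕ, ∀ w : Fin n → Fin 4, ∀ x y : ℝ,
      |affWord ρ t (List.ofFn fun i => (w i : ℕ)) x - affWord ρ t (List.ofFn fun i => (w i : ℕ)) y|
        = (∏ i, ρ (w i)) * |x - y| := by
    intro n
    induction n with
    | zero => intro w x y; simp [affWord]
    | succ n ih =>
      intro w x y
      rw [List.ofFn_succ]
      simp only [affWord, Function.comp, affMap]
      have h := ih (fun i => w i.succ) x y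
      rw [Fin.prod_univ_succ, mul_assoc, ← h, ← abs_of_pos (G.pos (w 0) (w 0).2), ← abs_mul,
        abs_of_pos (G.pos (w 0) (w 0).2)]
      congr 1; ring
  have hcov : ∀ n : ℕ, T ⊆ ⋃ w : Fin n → Fin 4, affWord ρ t (List.ofFn fun i => (w i : ℕ)) '' T := by
    intro n
    induction n with
    | zero => intro x hx; simp [affWord, hx]
    | succ n ih =>
      intro x hx
      obtain ⟨i, hi, y, hy, rfl⟩ := G.dec x hx
      obtain ⟨w, hw⟩ := Set.mem_iUnion.1 (ih hy)
      obtain ⟨z, hz, hzy⟩ := hw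
      refine Set.mem_iUnion.2 ⟨Fin.cons ⟨i, hi⟩ w, z, hz, ?_⟩
      rw [List.ofFn_succ]
      simp [affWord, affMap, hzy]
  obtain ⟨R, hR0, hR1, hR⟩ : ∃ R, 0 ≤ R ∧ R < 1 ∧ ∀ i, i < 4 → ρ i ≤ R := by
    refine ⟨max (max (ρ 0) (ρ 1)) (max (ρ 2) (ρ 3)), ?_, ?_, ?_⟩
    · simp [(G.pos 0 (by norm_num)).le]
    · simp [G.lt1]
    · intro i hi
      interval_cases i <;> simp
  have hed : ∀ n : ℕ, ∀ w : Fin n → Fin 4,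
      Metric.ediam (affWord ρ t (List.ofFn fun i => (w i : ℕ)) '' T) ≤
        ENNReal.ofReal (∏ i, ρ (w i)) := by
    intro n w
    apply Metric.ediam_le
    rintro _ ⟨x, hx, rfl⟩ _ ⟨y, hy, rfl⟩
    rw [edist_dist, Real.dist_eq, hdiam]
    apply ENNReal.ofReal_le_ofReal
    have h1 : 0 ≤ ∏ i, ρ (w i) := Finset.prod_nonneg fun i _ => (G.pos _ (w i).2).le
    have h2 : |x - y| ≤ 1 := by
      have := G.nn x hx
      have := G.nn y hy
      have := G.le1 x hx
      have := G.le1 y hy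
      rw [abs_le]; constructor <;> linarith
    nlinarith
  have h := Measure.hausdorffMeasure_le_liminf_sum (β := ℕ) (ι := fun n => Fin n → Fin 4) s T
    (l := Filter.atTop)
    (fun n => ENNReal.ofReal (R ^ n))
    (by simpa using ENNReal.tendsto_ofReal (tendsto_pow_atTop_nhds_zero_of_lt_one hR0 hR1))
    (fun n w => affWord ρ t (List.ofFn fun i => (w i : ℕ)) '' T)
    (Filter.Eventually.of_forall fun n w => (hed n w).trans (ENNReal.ofReal_le_ofReal (by
      calc ∏ i, ρ (w i) ≤ ∏ i : Fin n, R :=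
            Finset.prod_le_prod (fun i _ => (G.pos _ (w i).2).le) (fun i _ => hR _ (w i).2)
        _ = R ^ n := by simp)))
    (Filter.Eventually.of_forall fun n => hcov n)
  have hb : ∀ n : ℕ, ∑ w : Fin n → Fin 4,
      Metric.ediam (affWord ρ t (List.ofFn fun i => (w i : ℕ)) '' T) ^ s ≤ 1 := by
    intro n
    calc ∑ w : Fin n → Fin 4,
      Metric.ediam (affWord ρ t (List.ofFn fun i => (w i : ℕ)) '' T) ^ s
        ≤ ∑ w : Fin n → Fin 4, ENNReal.ofReal (∏ i, ρ (w i) ^ s) := by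
          apply Finset.sum_le_sum
          intro w _
          refine (ENNReal.rpow_le_rpow (hed n w) G.s0.le).trans ?_
          rw [ENNReal.ofReal_rpow_of_nonneg
            (Finset.prod_nonneg fun i _ => (G.pos _ (w i).2).le) G.s0.le,
            Real.finsetProd_rpow _ _ (fun i _ => (G.pos _ (w i).2).le)]
      _ = ENNReal.ofReal (∑ w : Fin n → Fin 4, ∏ i, ρ (w i) ^ s) := by
          rw [ENNReal.ofReal_sum_of_nonneg]
          exact fun w _ => Finset.prod_nonneg fun i _ => (G.ppos _ (w i).2).le
      _ = 1 := by
          rw [← Fintype.sum_pow (fun a : Fin 4 => ρ a ^ s) n]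
          have : ∑ a : Fin 4, ρ a ^ s = 1 := by
            rw [Fin.sum_univ_four]; exact G.hs
          rw [this]; simp
  have : μH[s] T ≤ 1 := by
    refine h.trans ?_
    refine Filter.liminf_le_of_frequently_le' (Filter.Frequently.of_forall hb)
  exact ne_top_of_le_ne_top ENNReal.one_ne_top this

end

section
variable {ρ t : ℕ → ℝ} {T : Set ℝ} {s : ℝ}

theorem Geo.mscale (G : Geo ρ t T s) {i : ℕ} (hi : i < 4) (A : Set ℝ) :
    μH[s] (affMap ρ t i '' A) = ENNReal.ofReal (ρ i ^ s) * μH[s] A := by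
  open scoped Pointwise in
  have e : affMap ρ t i '' A = IsometryEquiv.addRight (t i) '' (ρ i • A) := by
    rw [← Set.image_smul, Set.image_image]; rfl
  have hp := G.pos i hi
  rw [e, IsometryEquiv.hausdorffMeasure_image, Measure.hausdorffMeasure_smul₀ G.s0.le hp.ne']
  rw [ENNReal.smul_def, smul_eq_mul]
  congr 1
  rw [← ENNReal.ofReal_coe_nnreal]
  congr 1
  simp [abs_of_pos hp]

theorem Geo.inter (G : Geo ρ t T s) {i j : ℕ} (hi : i < 4) (hj : j < 4) (hij : i ≠ j) {x : ℝ}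
    (h1 : x ∈ affMap ρ t i '' T) (h2 : x ∈ affMap ρ t j '' T) :
    x = t 2 ∧ ((i = 1 ∧ j = 2) ∨ (i = 2 ∧ j = 1)) := by
  have p0 := G.pos 0 (by norm_num)
  have p1 := G.pos 1 (by norm_num)
  have p2 := G.pos 2 (by norm_num)
  have p3 := G.pos 3 (by norm_num)
  have t0 := G.t0
  have g0 := G.g0
  have t12 := G.t12
  have g2 := G.g2
  have t3 := G.t3
  obtain ⟨y, hy, ey⟩ := h1
  obtain ⟨z, hz, ez⟩ := h2
  simp only [affMap] at ey ez
  have y0 := G.nn y hy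
  have y1 := G.le1 y hy
  have z0 := G.nn z hz
  have z1 := G.le1 z hz
  have pi := G.pos i hi
  have pj := G.pos j hj
  have mi0 : 0 ≤ ρ i * y := by positivity
  have mi1 : ρ i * y ≤ ρ i := by nlinarith
  have mj0 : 0 ≤ ρ j * z := by positivity
  have mj1 : ρ j * z ≤ ρ j := by nlinarith
  interval_cases i <;> interval_cases j <;> first
    | (exfalso; exact hij rfl)
    | (exfalso; linarith)
    | (refine ⟨by linarith, by simp⟩)

theorem Geo.inj (G : Geo ρ t T s) {i : ℕ} (hi : i < 4) : Function.Injective (affMap ρ t i) := by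
  intro x y h
  have := (G.pos i hi).ne'
  simp only [affMap] at h
  have h2 : ρ i * x = ρ i * y := by linarith
  exact mul_left_cancel₀ this h2

theorem Geo.img_sub (G : Geo ρ t T s) {i : ℕ} (hi : i < 4) {A : Set ℝ} (hA : A ⊆ T) :
    affMap ρ t i '' A ⊆ T := by
  rintro _ ⟨x, hx, rfl⟩
  exact G.inc i hi x (hA hx)

theorem ratio_lem {m : Measure ℝ} {A B : Set ℝ} {τ : ENNReal} (h0 : τ ≠ 0) (h1 : τ ≠ ⊤)
    {x y z : ℝ} (hA : m A = ENNReal.ofReal x * τ) (hB : m B = ENNReal.ofReal y * τ)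
    (hy : 0 < y) (hz : x / y = z) : m A / m B = ENNReal.ofReal z := by
  rw [hA, hB, ENNReal.mul_div_mul_right _ _ h0 h1, ← ENNReal.ofReal_div_of_pos hy, hz]

theorem img_nontriv {f : ℝ → ℝ} (hf : Function.Injective f) {A : Set ℝ} (h : A.Nontrivial) :
    (f '' A).Nontrivial := h.image hf

end

section
variable {ρ : ℕ → ℝ} {S : TouchingIFS 4 ρ} {s : ℝ}

theorem cyl_cons (i : ℕ) (w : List ℕ) : S.cyl (i :: w) = affMap ρ S.t i '' S.cyl w := by
  simp [TouchingIFS.cyl, affWord, Set.image_comp]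

theorem cyl_nil : S.cyl [] = S.T := by
  simp [TouchingIFS.cyl, affWord]

theorem Geo.cyl_sub (G : Geo ρ S.t S.T s) {w : List ℕ} (hw : ∀ i ∈ w, i < 4) : S.cyl w ⊆ S.T := by
  induction w with
  | nil => rw [cyl_nil]
  | cons i w ih =>
    rw [cyl_cons]
    exact G.img_sub (hw i (by simp)) (ih fun j hj => hw j (by simp [hj]))

theorem Geo.cyl_nt (G : Geo ρ S.t S.T s) {w : List ℕ} (hw : ∀ i ∈ w, i < 4) :
    (S.cyl w).Nontrivial := by
  induction w with
  | nil => rw [cyl_nil]; exact ⟨0, G.zero, 1, G.one, zero_ne_one⟩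
  | cons i w ih =>
    rw [cyl_cons]
    exact (ih fun j hj => hw j (by simp [hj])).image (G.inj (hw i (by simp)))

theorem rep_lt {e k : ℕ} (he : e < 4) : ∀ i ∈ List.replicate k e, i < 4 := by
  intro i hi
  rw [List.eq_of_mem_replicate hi]; exact he

theorem cons_rep_lt {a e k : ℕ} (ha : a < 4) (he : e < 4) :
    ∀ i ∈ a :: List.replicate k e, i < 4 := by
  intro i hi
  rcases List.mem_cons.1 hi with rfl | h
  · exact ha
  · exact rep_lt he i h

theorem Geo.m_rep (G : Geo ρ S.t S.T s) {e : ℕ} (he : e < 4) (k : ℕ) :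
    μH[s] (S.cyl (List.replicate k e)) = ENNReal.ofReal ((ρ e ^ s) ^ k) * μH[s] S.T := by
  induction k with
  | zero => simp [cyl_nil]
  | succ k ih =>
    rw [List.replicate_succ, cyl_cons, G.mscale he, ih, ← mul_assoc,
      ← ENNReal.ofReal_mul (G.ppos e he).le, pow_succ']

/-- The set `E_k`. -/
def EE (S : TouchingIFS 4 ρ) (k : ℕ) : Set ℝ :=
  S.cyl (1 :: List.replicate k 3) ∪ S.cyl (2 :: List.replicate k 0)

theorem Geo.m_EE (G : Geo ρ S.t S.T s) (h14 : ρ 0 = ρ 3) (k : ℕ) :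
    μH[s] (EE S k) = ENNReal.ofReal ((ρ 1 ^ s + ρ 2 ^ s) * (ρ 0 ^ s) ^ k) * μH[s] S.T := by
  have hp0 := G.ppos 0 (by norm_num)
  have hp1 := G.ppos 1 (by norm_num)
  have hp2 := G.ppos 2 (by norm_num)
  have hcl : ∀ w, MeasurableSet (S.cyl w) := by
    intro w
    induction w with
    | nil => rw [cyl_nil]; exact G.cpt.isClosed.measurableSet
    | cons i w ih =>
      have hc : ∀ w, IsCompact (S.cyl w) := by
        intro w
        induction w with
        | nil => rw [cyl_nil]; exact G.cpt
        | cons i w ih =>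
          rw [cyl_cons]
          apply ih.image
          unfold affMap
          fun_prop
      exact (hc _).isClosed.measurableSet
  have hnull : μH[s] (S.cyl (1 :: List.replicate k 3) ∩ S.cyl (2 :: List.replicate k 0)) = 0 := by
    have := Measure.nullSingletonClass_hausdorff ℝ G.s0
    apply measure_mono_null (t := {S.t 2}) _ (measure_singleton _)
    rintro x ⟨h1, h2⟩
    rw [cyl_cons] at h1 h2
    exact (G.inter (i := 1) (j := 2) (by norm_num) (by norm_num) (by norm_num)
      (Set.image_mono (G.cyl_sub (rep_lt (by norm_num))) h1)
      (Set.image_mono (G.cyl_sub (rep_lt (by norm_num))) h2)).1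
  have h := measure_union_add_inter (μ := μH[s]) (S.cyl (1 :: List.replicate k 3))
    (hcl (2 :: List.replicate k 0))
  rw [hnull, add_zero] at h
  rw [EE, h, cyl_cons, cyl_cons, G.mscale (by norm_num), G.mscale (by norm_num),
    G.m_rep (by norm_num), G.m_rep (by norm_num), ← h14, ← mul_assoc, ← mul_assoc, ← add_mul,
    ← ENNReal.ofReal_mul hp1.le, ← ENNReal.ofReal_mul hp2.le,
    ← ENNReal.ofReal_add (by positivity) (by positivity)]
  congr 2
  ring

theorem Geo.EE_nt (G : Geo ρ S.t S.T s) (k : ℕ) : (EE S k).Nontrivial :=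
  (G.cyl_nt (cons_rep_lt (by norm_num) (by norm_num))).mono Set.subset_union_left

theorem Geo.EE_sub (G : Geo ρ S.t S.T s) (k : ℕ) : EE S k ⊆ S.T :=
  Set.union_subset (G.cyl_sub (cons_rep_lt (by norm_num) (by norm_num)))
    (G.cyl_sub (cons_rep_lt (by norm_num) (by norm_num)))

/-- The structural facts about the families used in the upper inclusion. -/
structure Fam (S : TouchingIFS 4 ρ) (E : ℕ → Set (Set ℝ)) : Prop where
  e0 : E 0 = {S.T}
  e1 : E 1 = {S.cyl [0], S.cyl [3], EE S 0}
  step : ∀ k, ∀ A ∈ E (k + 1), (∃ i, i < 4 ∧ ∃ A' ∈ E k, A = affMap ρ S.t i '' A') ∨ A = EE S k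

theorem Fam.sub {E : ℕ → Set (Set ℝ)} (H : Fam S E) (G : Geo ρ S.t S.T s) (k : ℕ) :
    ∀ A ∈ E k, A ⊆ S.T ∧ A.Nontrivial := by
  induction k with
  | zero =>
    intro A hA
    rw [H.e0] at hA
    rw [hA]
    exact ⟨le_rfl, cyl_nil (S := S) ▸ G.cyl_nt (by simp)⟩
  | succ k ih =>
    intro A hA
    rcases H.step k A hA with ⟨i, hi, A', hA', rfl⟩ | rfl
    · exact ⟨G.img_sub hi (ih A' hA').1, (ih A' hA').2.image (G.inj hi)⟩
    · exact ⟨G.EE_sub k, G.EE_nt k⟩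

theorem Geo.no_sub (G : Geo ρ S.t S.T s) {i j : ℕ} (hi : i < 4) (hj : j < 4) {A : Set ℝ}
    (hA : A.Nontrivial) (h1 : A ⊆ affMap ρ S.t i '' S.T) (h2 : A ⊆ affMap ρ S.t j '' S.T) :
    i = j := by
  by_contra hij
  obtain ⟨x, hx, y, hy, hxy⟩ := hA
  exact hxy ((G.inter hi hj hij (h1 hx) (h2 hx)).1.trans (G.inter hi hj hij (h1 hy) (h2 hy)).1.symm)

theorem Geo.cyl_cons_sub (G : Geo ρ S.t S.T s) {i e k : ℕ} (he : e < 4) :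
    S.cyl (i :: List.replicate k e) ⊆ affMap ρ S.t i '' S.T := by
  rw [cyl_cons]
  exact Set.image_mono (G.cyl_sub (rep_lt he))

theorem Geo.EE_not_sub (G : Geo ρ S.t S.T s) {j k : ℕ} (hj : j < 4)
    (h : EE S k ⊆ affMap ρ S.t j '' S.T) : False := by
  have h1 := G.no_sub (i := 1) (j := j) (by norm_num) hj
    (G.cyl_nt (w := 1 :: List.replicate k 3) (cons_rep_lt (by norm_num) (by norm_num)))
    (G.cyl_cons_sub (by norm_num)) (Set.subset_union_left.trans h)
  have h2 := G.no_sub (i := 2) (j := j) (by norm_num) hj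
    (G.cyl_nt (w := 2 :: List.replicate k 0) (cons_rep_lt (by norm_num) (by norm_num)))
    (G.cyl_cons_sub (by norm_num)) (Set.subset_union_right.trans h)
  omega

theorem Fam.end_lem {E : ℕ → Set (Set ℝ)} (H : Fam S E) (G : Geo ρ S.t S.T s) (h14 : ρ 0 = ρ 3)
    {e : ℕ} (he : e < 4) (hρe : ρ e = ρ 0) (k : ℕ) :
    ∀ A ∈ E (k + 1), A ⊆ S.cyl (List.replicate k e) →
      μH[s] A = ENNReal.ofReal (ρ 0 ^ s * (ρ 0 ^ s) ^ k) * μH[s] S.T ∨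
      μH[s] A = ENNReal.ofReal ((ρ 1 ^ s + ρ 2 ^ s) * (ρ 0 ^ s) ^ k) * μH[s] S.T := by
  induction k with
  | zero =>
    intro A hA _
    rw [H.e1] at hA
    rcases hA with rfl | rfl | rfl
    · left; rw [cyl_cons, cyl_nil, G.mscale (by norm_num)]; simp
    · left; rw [cyl_cons, cyl_nil, G.mscale (by norm_num), ← h14]; simp
    · right; exact G.m_EE h14 0
  | succ k ih =>
    intro A hA hsub
    rw [List.replicate_succ] at hsub
    have hsub2 := hsub.trans (G.cyl_cons_sub he)
    rcases H.step _ A hA with ⟨i, hi, A', hA', rfl⟩ | rfl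
    · have hA2 := H.sub G _ A' hA'
      have hie : i = e := G.no_sub hi he (hA2.2.image (G.inj hi)) (Set.image_mono hA2.1) hsub2
      subst hie
      rw [cyl_cons] at hsub
      have hp0 := G.ppos 0 (by norm_num)
      rcases ih A' hA' ((Set.image_subset_image_iff (G.inj hi)).1 hsub) with h | h
      · left
        rw [G.mscale hi, h, hρe, ← mul_assoc, ← ENNReal.ofReal_mul hp0.le]
        congr 2; ring
      · right
        rw [G.mscale hi, h, hρe, ← mul_assoc, ← ENNReal.ofReal_mul hp0.le]
        congr 2; ring
    · exact (G.EE_not_sub he hsub2).elim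

theorem Geo.one_rep (G : Geo ρ S.t S.T s) (k : ℕ) : (1:ℝ) ∈ S.cyl (List.replicate k 3) := by
  induction k with
  | zero => simpa [cyl_nil] using G.one
  | succ k ih =>
    rw [List.replicate_succ, cyl_cons]
    exact ⟨1, ih, by have := G.t3; simp only [affMap]; linarith⟩

theorem Geo.zero_rep (G : Geo ρ S.t S.T s) (k : ℕ) : (0:ℝ) ∈ S.cyl (List.replicate k 0) := by
  induction k with
  | zero => simpa [cyl_nil] using G.zero
  | succ k ih =>
    rw [List.replicate_succ, cyl_cons]
    exact ⟨0, ih, by have := G.t0; simp only [affMap]; linarith⟩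

theorem Geo.sub_EE (G : Geo ρ S.t S.T s) {i k : ℕ} (hi : i < 4) {A : Set ℝ} (hA : A ⊆ S.T)
    (hne : A.Nontrivial) (h : affMap ρ S.t i '' A ⊆ EE S k) :
    (i = 1 ∧ A ⊆ S.cyl (List.replicate k 3)) ∨ (i = 2 ∧ A ⊆ S.cyl (List.replicate k 0)) := by
  have hA' : affMap ρ S.t i '' A ⊆ affMap ρ S.t i '' S.T := Set.image_mono hA
  have c1 : S.cyl (1 :: List.replicate k 3) ⊆ affMap ρ S.t 1 '' S.T := G.cyl_cons_sub (by norm_num)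
  have c2 : S.cyl (2 :: List.replicate k 0) ⊆ affMap ρ S.t 2 '' S.T := G.cyl_cons_sub (by norm_num)
  have hi12 : i = 1 ∨ i = 2 := by
    by_contra hcon
    push Not at hcon
    obtain ⟨x, hx⟩ := hne.nonempty
    have hx' := Set.mem_image_of_mem (affMap ρ S.t i) hx
    rcases h hx' with h1 | h1
    · have := (G.inter hi (by norm_num) hcon.1 (hA' hx') (c1 h1)).2
      omega
    · have := (G.inter hi (by norm_num) hcon.2 (hA' hx') (c2 h1)).2
      omega
  rcases hi12 with rfl | rfl
  · left
    refine ⟨rfl, ?_⟩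
    rw [← Set.image_subset_image_iff (G.inj hi), ← cyl_cons]
    intro x hx
    rcases h hx with h1 | h1
    · exact h1
    · have := (G.inter hi (by norm_num) (by norm_num) (hA' hx) (c2 h1)).1
      rw [this, cyl_cons]
      exact ⟨1, G.one_rep k, by have := G.t12; simp only [affMap]; linarith⟩
  · right
    refine ⟨rfl, ?_⟩
    rw [← Set.image_subset_image_iff (G.inj hi), ← cyl_cons]
    intro x hx
    rcases h hx with h1 | h1
    · have := (G.inter hi (by norm_num) (by norm_num) (hA' hx) (c1 h1)).1
      rw [this, cyl_cons]
      exact ⟨0, G.zero_rep k, by simp only [affMap]; linarith⟩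
    · exact h1

theorem Fam.upper {E : ℕ → Set (Set ℝ)} (H : Fam S E) (G : Geo ρ S.t S.T s) (h14 : ρ 0 = ρ 3)
    (k : ℕ) : ∀ A ∈ E (k + 1), ∀ B ∈ E k, A ⊆ B → μH[s] A / μH[s] B ∈
      ({ENNReal.ofReal (ρ 0 ^ s), ENNReal.ofReal (ρ 1 ^ s), ENNReal.ofReal (ρ 2 ^ s),
       ENNReal.ofReal (ρ 1 ^ s + ρ 2 ^ s),
       ENNReal.ofReal (ρ 0 ^ s * ρ 1 ^ s / (ρ 1 ^ s + ρ 2 ^ s)),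
       ENNReal.ofReal (ρ 0 ^ s * ρ 2 ^ s / (ρ 1 ^ s + ρ 2 ^ s))} : Set ENNReal) := by
  have hp0 := G.ppos 0 (by norm_num)
  have hp1 := G.ppos 1 (by norm_num)
  have hp2 := G.ppos 2 (by norm_num)
  have τ0 := G.pos_meas
  have τ1 := G.fin_meas
  induction k with
  | zero =>
    intro A hA B hB _
    rw [H.e0] at hB
    rw [H.e1] at hA
    rw [hB]
    have hT : μH[s] S.T = ENNReal.ofReal 1 * μH[s] S.T := by simp
    rcases hA with rfl | rfl | rfl
    · rw [ratio_lem τ0 τ1 (z := ρ 0 ^ s)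
        (by rw [cyl_cons, cyl_nil, G.mscale (by norm_num)]) hT one_pos (by simp)]
      simp
    · rw [ratio_lem τ0 τ1 (z := ρ 0 ^ s)
        (by rw [cyl_cons, cyl_nil, G.mscale (by norm_num)]) hT one_pos (by simp [h14])]
      simp
    · rw [ratio_lem τ0 τ1 (z := ρ 1 ^ s + ρ 2 ^ s)
        (G.m_EE h14 0) hT one_pos (by simp)]
      simp
  | succ k ih =>
    intro A hA B hB hAB
    rcases H.step _ A hA with ⟨i, hi, A', hA', rfl⟩ | rfl
    · have hA2 := H.sub G _ A' hA'
      rcases H.step _ B hB with ⟨j, hj, B', hB', rfl⟩ | rfl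
      · have hB2 := H.sub G _ B' hB'
        have hij : i = j := G.no_sub hi hj (hA2.2.image (G.inj hi)) (Set.image_mono hA2.1)
          (hAB.trans (Set.image_mono hB2.1))
        subst hij
        rw [G.mscale hi, G.mscale hi, ENNReal.mul_div_mul_left _ _
          (by simpa using G.ppos i hi) ENNReal.ofReal_ne_top]
        exact ih A' hA' B' hB' ((Set.image_subset_image_iff (G.inj hi)).1 hAB)
      · have hd : 0 < (ρ 1 ^ s + ρ 2 ^ s) * (ρ 0 ^ s) ^ k := by positivity
        rcases G.sub_EE hi hA2.1 hA2.2 hAB with ⟨rfl, hs⟩ | ⟨rfl, hs⟩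
        · rcases H.end_lem G h14 (e := 3) (by norm_num) h14.symm k A' hA' hs with h | h
          · rw [ratio_lem τ0 τ1 (x := ρ 1 ^ s * (ρ 0 ^ s * (ρ 0 ^ s) ^ k))
              (z := ρ 0 ^ s * ρ 1 ^ s / (ρ 1 ^ s + ρ 2 ^ s))
              (by rw [G.mscale hi, h, ← mul_assoc, ← ENNReal.ofReal_mul hp1.le])
              (G.m_EE h14 k) hd (by field_simp)]
            simp
          · rw [ratio_lem τ0 τ1 (x := ρ 1 ^ s * ((ρ 1 ^ s + ρ 2 ^ s) * (ρ 0 ^ s) ^ k))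
              (z := ρ 1 ^ s)
              (by rw [G.mscale hi, h, ← mul_assoc, ← ENNReal.ofReal_mul hp1.le])
              (G.m_EE h14 k) hd (by field_simp)]
            simp
        · rcases H.end_lem G h14 (e := 0) (by norm_num) rfl k A' hA' hs with h | h
          · rw [ratio_lem τ0 τ1 (x := ρ 2 ^ s * (ρ 0 ^ s * (ρ 0 ^ s) ^ k))
              (z := ρ 0 ^ s * ρ 2 ^ s / (ρ 1 ^ s + ρ 2 ^ s))
              (by rw [G.mscale hi, h, ← mul_assoc, ← ENNReal.ofReal_mul hp2.le])
              (G.m_EE h14 k) hd (by field_simp)]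
            simp
          · rw [ratio_lem τ0 τ1 (x := ρ 2 ^ s * ((ρ 1 ^ s + ρ 2 ^ s) * (ρ 0 ^ s) ^ k))
              (z := ρ 2 ^ s)
              (by rw [G.mscale hi, h, ← mul_assoc, ← ENNReal.ofReal_mul hp2.le])
              (G.m_EE h14 k) hd (by field_simp)]
            simp
    · rcases H.step _ B hB with ⟨j, hj, B', hB', rfl⟩ | rfl
      · exact (G.EE_not_sub hj (hAB.trans (Set.image_mono (H.sub G _ B' hB').1))).elim
      · have hd : 0 < (ρ 1 ^ s + ρ 2 ^ s) * (ρ 0 ^ s) ^ k := by positivity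
        rw [ratio_lem τ0 τ1 (z := ρ 0 ^ s) (G.m_EE h14 (k+1)) (G.m_EE h14 k) hd
          (by rw [pow_succ]; field_simp)]
        simp

end

/-- the possible Hausdorff-measure ratios between a member of `ℰ_{k+1}`
and the member of `ℰ_k` containing it are exactly
`{μ₁, μ₂, μ₃, μ₂+μ₃, μ₁μ₂/(μ₂+μ₃), μ₁μ₃/(μ₂+μ₃)}`. -/
theorem measure_ratio_set_eq {ρ : ℕ → ℝ}
    (hρ : ContractionVec 4 ρ) (hρ14 : ρ 0 = ρ 3)
    (S : TouchingIFS 4 ρ)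
    (htouch : S.touch 1) (hnt0 : ¬ S.touch 0) (hnt2 : ¬ S.touch 2)
    (s : ℝ) (hs : (∑ i ∈ Finset.range 4, ρ i ^ s) = 1)
    (ℰ : ℕ → Set (Set ℝ))
    (hE1 : ℰ 1 = {S.cyl [0], S.cyl [3], S.cyl [1] ∪ S.cyl [2]})
    (hrec : ∀ k, 1 ≤ k → ℰ (k + 1) =
      ((fun A => affMap ρ S.t 0 '' A) '' ℰ k) ∪ ((fun A => affMap ρ S.t 3 '' A) '' ℰ k) ∪
      (((fun A => affMap ρ S.t 1 '' A) '' ℰ k) \ {S.cyl (1 :: List.replicate k 3)}) ∪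
      (((fun A => affMap ρ S.t 2 '' A) '' ℰ k) \ {S.cyl (2 :: List.replicate k 0)}) ∪
      {S.cyl (1 :: List.replicate k 3) ∪ S.cyl (2 :: List.replicate k 0)}) :
    ∀ k, 1 ≤ k →
      {x : ENNReal | ∃ A ∈ ℰ (k + 1), ∃ B ∈ ℰ k, A ⊆ B ∧ x = μH[s] A / μH[s] B} =
      {ENNReal.ofReal (ρ 0 ^ s), ENNReal.ofReal (ρ 1 ^ s), ENNReal.ofReal (ρ 2 ^ s),
       ENNReal.ofReal (ρ 1 ^ s + ρ 2 ^ s),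
       ENNReal.ofReal (ρ 0 ^ s * ρ 1 ^ s / (ρ 1 ^ s + ρ 2 ^ s)),
       ENNReal.ofReal (ρ 0 ^ s * ρ 2 ^ s / (ρ 1 ^ s + ρ 2 ^ s))} := by
  have G := geo_of hρ S htouch hnt0 hnt2 s hs
  have hp0 := G.ppos 0 (by norm_num)
  have hp1 := G.ppos 1 (by norm_num)
  have hp2 := G.ppos 2 (by norm_num)
  have τ0 := G.pos_meas
  have τ1 := G.fin_meas
  -- extend the family by `{T}` at level zero
  let E : ℕ → Set (Set ℝ) := fun k => if k = 0 then {S.T} else ℰ k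
  have hE : ∀ k, 1 ≤ k → E k = ℰ k := fun k hk => if_neg (by omega)
  have H : Fam S E := by
    have e1 : E 1 = {S.cyl [0], S.cyl [3], EE S 0} := by
      rw [hE 1 le_rfl, hE1]; rfl
    refine ⟨rfl, e1, ?_⟩
    intro k A hA
    rcases Nat.eq_zero_or_pos k with rfl | hk
    · rw [e1] at hA
      rcases hA with rfl | rfl | rfl
      · exact Or.inl ⟨0, by norm_num, S.T, rfl, by rw [cyl_cons, cyl_nil]⟩
      · exact Or.inl ⟨3, by norm_num, S.T, rfl, by rw [cyl_cons, cyl_nil]⟩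
      · exact Or.inr rfl
    · rw [hE (k+1) (by omega), hrec k hk, ← hE k hk] at hA
      rcases hA with (((⟨B, hB, rfl⟩ | ⟨B, hB, rfl⟩) | ⟨⟨B, hB, rfl⟩, _⟩) | ⟨⟨B, hB, rfl⟩, _⟩) | h
      · exact Or.inl ⟨0, by norm_num, B, hB, rfl⟩
      · exact Or.inl ⟨3, by norm_num, B, hB, rfl⟩
      · exact Or.inl ⟨1, by norm_num, B, hB, rfl⟩
      · exact Or.inl ⟨2, by norm_num, B, hB, rfl⟩
      · exact Or.inr h
  intro k hk
  apply Set.Subset.antisymm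
  · rintro x ⟨A, hA, B, hB, hAB, rfl⟩
    rw [← hE _ (by omega)] at hA hB
    exact H.upper G hρ14 k A hA B hB hAB
  · induction k, hk using Nat.le_induction with
    | succ k hk ih =>
      intro x hx
      obtain ⟨A, hA, B, hB, hAB, rfl⟩ := ih hx
      refine ⟨affMap ρ S.t 0 '' A, ?_, affMap ρ S.t 0 '' B, ?_, Set.image_mono hAB, ?_⟩
      · rw [hrec (k+1) (by omega)]
        exact Or.inl (Or.inl (Or.inl (Or.inl ⟨A, hA, rfl⟩)))
      · rw [hrec k hk]
        exact Or.inl (Or.inl (Or.inl (Or.inl ⟨B, hB, rfl⟩)))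
      · rw [G.mscale (by norm_num), G.mscale (by norm_num), ENNReal.mul_div_mul_left _ _
          (by simpa using hp0) ENNReal.ofReal_ne_top]
    | base =>
      have c0 : S.cyl [0] = affMap ρ S.t 0 '' S.T := by rw [cyl_cons, cyl_nil]
      have c1 : S.cyl [1] = affMap ρ S.t 1 '' S.T := by rw [cyl_cons, cyl_nil]
      have c2 : S.cyl [2] = affMap ρ S.t 2 '' S.T := by rw [cyl_cons, cyl_nil]
      have c3 : S.cyl [3] = affMap ρ S.t 3 '' S.T := by rw [cyl_cons, cyl_nil]
      have hEE : EE S 0 = S.cyl [1] ∪ S.cyl [2] := rfl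
      have m0 : S.cyl [0] ∈ ℰ 1 := by rw [hE1]; simp
      have m3 : S.cyl [3] ∈ ℰ 1 := by rw [hE1]; simp
      have mE : EE S 0 ∈ ℰ 1 := by rw [hE1, hEE]; simp
      have nt0 : (S.cyl [0]).Nontrivial := G.cyl_nt (by simp)
      have nt3 : (S.cyl [3]).Nontrivial := G.cyl_nt (by simp)
      have n03 : S.cyl [0] ≠ S.cyl [3] := by
        intro h
        have := G.no_sub (i := 0) (j := 3) (by norm_num) (by norm_num) nt0 c0.le (h.trans c3).le
        omega
      have nE : ∀ j, j < 4 → EE S 0 ≠ S.cyl [j] := by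
        intro j hj h
        rw [cyl_cons, cyl_nil] at h
        exact G.EE_not_sub hj h.le
      have m4E : μH[s] (EE S 0) = ENNReal.ofReal (ρ 1 ^ s + ρ 2 ^ s) * μH[s] S.T := by
        simpa using G.m_EE hρ14 0
      have mm0 : μH[s] (S.cyl [0]) = ENNReal.ofReal (ρ 0 ^ s) * μH[s] S.T := by
        rw [c0, G.mscale (by norm_num)]
      have mm3 : μH[s] (S.cyl [3]) = ENNReal.ofReal (ρ 0 ^ s) * μH[s] S.T := by
        rw [c3, G.mscale (by norm_num), hρ14]
      have hd : 0 < ρ 1 ^ s + ρ 2 ^ s := by positivity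
      have s0 : S.cyl [0] ⊆ S.T := G.cyl_sub (by simp)
      have s3 : S.cyl [3] ⊆ S.T := G.cyl_sub (by simp)
      have sE : EE S 0 ⊆ S.T := G.EE_sub 0
      have i1 : ∀ A, A ⊆ S.T → affMap ρ S.t 1 '' A ⊆ EE S 0 := fun A hA => by
        rw [hEE, c1]; exact (Set.image_mono hA).trans Set.subset_union_left
      have i2 : ∀ A, A ⊆ S.T → affMap ρ S.t 2 '' A ⊆ EE S 0 := fun A hA => by
        rw [hEE, c2]; exact (Set.image_mono hA).trans Set.subset_union_right
      have b0 : ∀ A ∈ ℰ 1, affMap ρ S.t 0 '' A ∈ ℰ (1+1) := by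
        intro A hA
        rw [hrec 1 le_rfl]
        exact Or.inl (Or.inl (Or.inl (Or.inl ⟨A, hA, rfl⟩)))
      have b1 : ∀ A ∈ ℰ 1, A ≠ S.cyl [3] → affMap ρ S.t 1 '' A ∈ ℰ (1+1) := by
        intro A hA hne
        rw [hrec 1 le_rfl]
        refine Or.inl (Or.inl (Or.inr ⟨⟨A, hA, rfl⟩, ?_⟩))
        intro h
        rw [Set.mem_singleton_iff, cyl_cons] at h
        exact hne ((Set.image_injective.2 (G.inj (by norm_num))) h)
      have b2 : ∀ A ∈ ℰ 1, A ≠ S.cyl [0] → affMap ρ S.t 2 '' A ∈ ℰ (1+1) := by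
        intro A hA hne
        rw [hrec 1 le_rfl]
        refine Or.inl (Or.inr ⟨⟨A, hA, rfl⟩, ?_⟩)
        intro h
        rw [Set.mem_singleton_iff, cyl_cons] at h
        exact hne ((Set.image_injective.2 (G.inj (by norm_num))) h)
      have sc : ∀ i, i < 4 → ∀ A y, μH[s] A = ENNReal.ofReal y * μH[s] S.T →
          μH[s] (affMap ρ S.t i '' A) = ENNReal.ofReal (ρ i ^ s * y) * μH[s] S.T := by
        intro i hi A y h
        rw [G.mscale hi, h, ← mul_assoc, ← ENNReal.ofReal_mul (G.ppos i hi).le]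
      rintro x (rfl | rfl | rfl | rfl | rfl | rfl)
      · exact ⟨_, b0 _ m0, _, m0, by rw [c0]; exact Set.image_mono (c0 ▸ s0),
          (ratio_lem τ0 τ1 (sc 0 (by norm_num) _ _ mm0) mm0 hp0 (by field_simp)).symm⟩
      · exact ⟨_, b1 _ mE (nE 3 (by norm_num)), _, mE, i1 _ sE,
          (ratio_lem τ0 τ1 (sc 1 (by norm_num) _ _ m4E) m4E hd (by field_simp)).symm⟩
      · exact ⟨_, b2 _ mE (nE 0 (by norm_num)), _, mE, i2 _ sE,
          (ratio_lem τ0 τ1 (sc 2 (by norm_num) _ _ m4E) m4E hd (by field_simp)).symm⟩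
      · exact ⟨_, b0 _ mE, _, m0, by rw [c0]; exact Set.image_mono sE,
          (ratio_lem τ0 τ1 (sc 0 (by norm_num) _ _ m4E) mm0 hp0 (by field_simp)).symm⟩
      · exact ⟨_, b1 _ m0 n03, _, mE, i1 _ s0,
          (ratio_lem τ0 τ1 (sc 1 (by norm_num) _ _ mm0) m4E hd (by ring)).symm⟩
      · exact ⟨_, b2 _ m3 n03.symm, _, mE, i2 _ s3,
          (ratio_lem τ0 τ1 (sc 2 (by norm_num) _ _ mm3) m4E hd (by ring)).symm⟩
end
end
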